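/- arXiv:1501.03878 — 2 statements merged into one kernel-verified Lean document; each statement's English description precedes it below -/
import Mathlib

section
/- For every integer N with 4 ≤ N ≤ 10 there exist countably infinitely many pairwise distinct nonconstant functions v : [0,π] → ℝ, each twice continuously differentiable on (0,π) and continuously differentiable on [0,π], satisfying v''(θ) + (N−2)(cos θ/sin θ) v'(θ) + 2(N−2)(e^{v(θ)} − 1) = 0 for all θ ∈ (0,π), v'(0) = v'(π) = 0, and v(θ) = v(π−θ) for all θ ∈ [0,π]. -/
open Real Set

/-- The solution operator of the first-order equation `p' + m cot(θ) p = g`, `p 0 = 0`. -/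
noncomputable def cotSolve (m : ℕ) (g : ℝ → ℝ) (θ : ℝ) : ℝ :=
  (sin θ ^ m)⁻¹ * ∫ r in (0:ℝ)..θ, sin r ^ m * g r

/-- The inverse of the operator `u ↦ u'' + m cot(θ) u'` with vanishing data at `0`. -/
noncomputable def cotSolve₂ (m : ℕ) (g : ℝ → ℝ) (θ : ℝ) : ℝ :=
  ∫ s in (0:ℝ)..θ, cotSolve m g s

lemma cotSolve_zero (m : ℕ) (g : ℝ → ℝ) : cotSolve m g 0 = 0 := by
  simp [cotSolve]

lemma abs_cotSolve_le (m : ℕ) {g : ℝ → ℝ} (hg : Continuous g) {θ : ℝ}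
    (hθ : θ ∈ Icc 0 (π / 2)) : |cotSolve m g θ| ≤ ∫ r in (0:ℝ)..θ, |g r| := by
  rcases hθ.1.eq_or_lt with h0 | h0
  · simp [← h0, cotSolve_zero]
  have hs : 0 < sin θ ^ m :=
    pow_pos (sin_pos_of_pos_of_lt_pi h0 (by linarith [hθ.2, pi_pos])) m
  rw [cotSolve, abs_mul, abs_inv, abs_of_pos hs, inv_mul_le_iff₀ hs,
    ← intervalIntegral.integral_const_mul]
  refine (intervalIntegral.abs_integral_le_integral_abs hθ.1).trans ?_
  refine intervalIntegral.integral_mono_on hθ.1 ?_ ?_ ?_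
  · exact Continuous.intervalIntegrable (by fun_prop) _ _
  · exact Continuous.intervalIntegrable (by fun_prop) _ _
  · intro r hr
    have h1 : 0 ≤ sin r :=
      sin_nonneg_of_nonneg_of_le_pi hr.1 (by linarith [hr.2, hθ.2, pi_pos])
    have h2 : sin r ≤ sin θ :=
      sin_le_sin_of_le_of_le_pi_div_two (by linarith [hr.1, pi_pos]) hθ.2 hr.2
    rw [abs_mul, abs_of_nonneg (pow_nonneg h1 m)]
    gcongr

lemma hasDerivAt_cotSolve (m : ℕ) {g : ℝ → ℝ} (hg : Continuous g) {θ : ℝ}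
    (hθ : θ ∈ Ioo 0 π) :
    HasDerivAt (cotSolve m g) (g θ - m * (cos θ / sin θ) * cotSolve m g θ) θ := by
  have hs : sin θ ≠ 0 := (sin_pos_of_pos_of_lt_pi hθ.1 hθ.2).ne'
  have h1 : HasDerivAt (fun x => ∫ r in (0:ℝ)..x, sin r ^ m * g r) (sin θ ^ m * g θ) θ :=
    (by fun_prop : Continuous fun r => sin r ^ m * g r).integral_hasStrictDerivAt 0 θ
      |>.hasDerivAt
  have h2 := (((hasDerivAt_sin θ).fun_pow m).fun_inv (pow_ne_zero m hs)).mul h1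
  refine h2.congr_deriv ?_
  rw [cotSolve]
  rcases m with _ | m
  · simp
  · simp only [Nat.add_sub_cancel]
    field_simp
    ring

lemma continuousOn_cotSolve (m : ℕ) {g : ℝ → ℝ} (hg : Continuous g) :
    ContinuousOn (cotSolve m g) (Ico 0 π) := by
  intro θ hθ
  rcases hθ.1.eq_or_lt with h0 | h0
  · subst h0
    have h1 : Filter.Tendsto (fun θ => ∫ r in (0:ℝ)..θ, |g r|) (nhdsWithin 0 (Ico 0 π))
        (nhds 0) := by
      have : Continuous fun θ => ∫ r in (0:ℝ)..θ, |g r| :=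
        intervalIntegral.continuous_primitive
          (fun a b => (by fun_prop : Continuous fun r => |g r|).intervalIntegrable a b) 0
      simpa using (this.tendsto 0).mono_left nhdsWithin_le_nhds
    rw [ContinuousWithinAt, cotSolve_zero]
    refine squeeze_zero_norm' ?_ h1
    have h2 : ∀ᶠ x in nhdsWithin (0:ℝ) (Ico 0 π), x < π / 2 :=
      (eventually_lt_nhds (by positivity : (0:ℝ) < π / 2)).filter_mono nhdsWithin_le_nhds
    filter_upwards [h2, self_mem_nhdsWithin] with x hx hx'
    exact abs_cotSolve_le m hg ⟨hx'.1, hx.le⟩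
  · exact (hasDerivAt_cotSolve m hg ⟨h0, hθ.2⟩).continuousAt.continuousWithinAt

lemma intervalIntegrable_cotSolve (m : ℕ) {g : ℝ → ℝ} (hg : Continuous g) {θ : ℝ}
    (hθ : θ ∈ Ico 0 π) :
    IntervalIntegrable (cotSolve m g) MeasureTheory.volume 0 θ := by
  apply ContinuousOn.intervalIntegrable
  rw [uIcc_of_le hθ.1]
  exact (continuousOn_cotSolve m hg).mono (Icc_subset_Ico_right hθ.2)

lemma hasDerivAt_cotSolve₂ (m : ℕ) {g : ℝ → ℝ} (hg : Continuous g) {θ : ℝ}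
    (hθ : θ ∈ Ioo 0 π) : HasDerivAt (cotSolve₂ m g) (cotSolve m g θ) θ := by
  refine intervalIntegral.integral_hasDerivAt_right
    (intervalIntegrable_cotSolve m hg ⟨hθ.1.le, hθ.2⟩) ?_
    (hasDerivAt_cotSolve m hg hθ).continuousAt
  exact ((continuousOn_cotSolve m hg).mono Ioo_subset_Ico_self).stronglyMeasurableAtFilter
    isOpen_Ioo θ hθ

lemma cotSolve_sub (m : ℕ) {f g : ℝ → ℝ} (hf : Continuous f) (hg : Continuous g) (θ : ℝ) :
    cotSolve m f θ - cotSolve m g θ = cotSolve m (fun r => f r - g r) θ := by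
  simp only [cotSolve, mul_sub]
  rw [intervalIntegral.integral_sub]
  · ring
  · exact Continuous.intervalIntegrable (by fun_prop) _ _
  · exact Continuous.intervalIntegrable (by fun_prop) _ _

lemma cotSolve₂_sub (m : ℕ) {f g : ℝ → ℝ} (hf : Continuous f) (hg : Continuous g) {θ : ℝ}
    (hθ : θ ∈ Ico 0 π) :
    cotSolve₂ m f θ - cotSolve₂ m g θ = cotSolve₂ m (fun r => f r - g r) θ := by
  simp only [cotSolve₂]
  rw [← intervalIntegral.integral_sub (intervalIntegrable_cotSolve m hf hθ)
    (intervalIntegrable_cotSolve m hg hθ)]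
  exact intervalIntegral.integral_congr fun s _ => cotSolve_sub m hf hg s

lemma abs_cotSolve₂_le (m : ℕ) {g : ℝ → ℝ} (hg : Continuous g) {θ : ℝ}
    (hθ : θ ∈ Icc 0 (π / 2)) : |cotSolve₂ m g θ| ≤ θ * ∫ r in (0:ℝ)..θ, |g r| := by
  have h := intervalIntegral.norm_integral_le_of_norm_le_const (a := 0) (b := θ)
    (f := cotSolve m g) (C := ∫ r in (0:ℝ)..θ, |g r|) ?_
  · rw [sub_zero, abs_of_nonneg hθ.1, mul_comm] at h
    exact h
  · intro s hs
    rw [uIoc_of_le hθ.1] at hs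
    refine (abs_cotSolve_le m hg ⟨hs.1.le, hs.2.trans hθ.2⟩).trans ?_
    exact intervalIntegral.integral_mono_interval le_rfl hs.1.le hs.2
      (Filter.Eventually.of_forall fun r => abs_nonneg (g r))
      (Continuous.intervalIntegrable (by fun_prop) _ _)

lemma continuousOn_cotSolve₂ (m : ℕ) {g : ℝ → ℝ} (hg : Continuous g) :
    ContinuousOn (cotSolve₂ m g) (Icc 0 (π / 2)) := by
  have hpi := pi_pos
  have := intervalIntegral.continuousOn_primitive_interval (μ := MeasureTheory.volume)
    (f := cotSolve m g) (a := 0) (b := π / 2) ?_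
  · rwa [uIcc_of_le (by positivity)] at this
  · rw [uIcc_of_le (by positivity)]
    exact ((continuousOn_cotSolve m hg).mono
      (Icc_subset_Ico_right (by linarith))).integrableOn_Icc

/-- The nonlinearity `a eᵘ - 1`, truncated above `u = 0` so as to be globally Lipschitz. -/
noncomputable def truncSource (a : ℝ) (u : ℝ → ℝ) (r : ℝ) : ℝ := a * exp (min (u r) 0) - 1

lemma abs_exp_min_sub_le (x y : ℝ) : |exp (min x 0) - exp (min y 0)| ≤ |x - y| := by
  have key : ∀ s t : ℝ, s ≤ t → t ≤ 0 → exp t - exp s ≤ t - s := by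
    intro s t _ ht
    have h1 := add_one_le_exp (s - t)
    have h2 : exp s = exp t * exp (s - t) := by rw [← exp_add]; ring_nf
    have h3 : exp t ≤ 1 := exp_le_one_iff.2 ht
    rw [h2]
    nlinarith [exp_pos t]
  have habs : |exp (min x 0) - exp (min y 0)| ≤ |min x 0 - min y 0| := by
    rcases le_total (min x 0) (min y 0) with h | h
    · rw [abs_sub_comm, abs_of_nonneg (sub_nonneg.2 (exp_le_exp.2 h)), abs_sub_comm,
        abs_of_nonneg (sub_nonneg.2 h)]
      exact key _ _ h (min_le_right _ _)
    · rw [abs_of_nonneg (sub_nonneg.2 (exp_le_exp.2 h)), abs_of_nonneg (sub_nonneg.2 h)]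
      exact key _ _ h (min_le_right _ _)
  refine habs.trans ?_
  simpa using abs_min_sub_min_le_max x 0 y 0

lemma continuous_truncSource (a : ℝ) {u : ℝ → ℝ} (hu : Continuous u) :
    Continuous (truncSource a u) := by
  unfold truncSource
  fun_prop

lemma abs_truncSource_le {a : ℝ} (ha : 1 ≤ a) (u : ℝ → ℝ) (r : ℝ) :
    |truncSource a u r| ≤ a := by
  have h1 : exp (min (u r) 0) ≤ 1 := exp_le_one_iff.2 (min_le_right _ _)
  have h2 := exp_pos (min (u r) 0)
  rw [truncSource, abs_le]
  constructor <;> nlinarith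

lemma abs_truncSource_sub_le {a b : ℝ} (hb : 0 ≤ b) (u v : ℝ → ℝ) (r : ℝ) :
    |truncSource a u r - truncSource b v r| ≤ |a - b| + b * |u r - v r| := by
  have h1 : exp (min (u r) 0) ≤ 1 := exp_le_one_iff.2 (min_le_right _ _)
  have h2 := exp_pos (min (u r) 0)
  have : truncSource a u r - truncSource b v r
      = (a - b) * exp (min (u r) 0) + b * (exp (min (u r) 0) - exp (min (v r) 0)) := by
    simp only [truncSource]; ring
  rw [this]
  refine (abs_add_le _ _).trans ?_
  rw [abs_mul, abs_mul, abs_of_pos h2, abs_of_nonneg hb]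
  have := abs_exp_min_sub_le (u r) (v r)
  gcongr
  exact mul_le_of_le_one_right (abs_nonneg _) h1

/-- Solutions of the truncated problem in integral form on `[0, π/2]`. -/
structure IsTruncSol (m : ℕ) (a : ℝ) (u : ℝ → ℝ) : Prop where
  continuous : Continuous u
  eq : ∀ θ ∈ Icc 0 (π / 2), u θ = -2 * m * cotSolve₂ m (truncSource a u) θ

lemma integral_exp_mul_le {K : ℝ} (hK : 0 < K) (θ : ℝ) :
    ∫ r in (0:ℝ)..θ, exp (K * r) ≤ exp (K * θ) / K := by
  have h : ∀ x ∈ uIcc 0 θ, HasDerivAt (fun r => exp (K * r) / K) (exp (K * x)) x := by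
    intro x _
    have := (((hasDerivAt_id x).const_mul K).exp).div_const K
    refine this.congr_deriv ?_
    simp only [id, mul_one]
    field_simp
  rw [intervalIntegral.integral_eq_sub_of_hasDerivAt h
    (Continuous.intervalIntegrable (by fun_prop) _ _)]
  simp only [mul_zero, exp_zero]
  have : 0 < 1 / K := by positivity
  linarith

lemma exists_isTruncSol (m : ℕ) {a : ℝ} (ha : 1 ≤ a) : ∃ u, IsTruncSol m a u := by
  have hpi := pi_pos
  have hab : (0:ℝ) ≤ π / 2 := by positivity
  set K : ℝ := 2 * m * π * a + 1 with hKdef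
  have hK : 0 < K := by positivity
  let ext : C(Icc (0:ℝ) (π / 2), ℝ) → ℝ → ℝ := fun w r => exp (K * r) * IccExtend hab w r
  have hext : ∀ w, Continuous (ext w) := fun w =>
    (by fun_prop : Continuous fun r => exp (K * r)).mul (w.continuous.Icc_extend')
  have hsrc : ∀ w, Continuous (truncSource a (ext w)) := fun w =>
    continuous_truncSource a (hext w)
  let Φ : C(Icc (0:ℝ) (π / 2), ℝ) → C(Icc (0:ℝ) (π / 2), ℝ) := fun w =>
    ⟨fun θ => exp (-(K * θ)) * (-2 * m * cotSolve₂ m (truncSource a (ext w)) θ), by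
      have := continuousOn_iff_continuous_domRestrict.1 (continuousOn_cotSolve₂ m (hsrc w))
      refine Continuous.mul (by fun_prop) (continuous_const.mul this)⟩
  have hΦ : ContractingWith (1 / 2) Φ := by
    refine ⟨by rw [← NNReal.coe_lt_coe]; norm_num, ?_⟩
    refine LipschitzWith.of_dist_le_mul fun w w' => ?_
    refine (ContinuousMap.dist_le (by positivity)).2 fun θ => ?_
    have hθ := θ.2
    have hθ' : (θ : ℝ) ∈ Ico 0 π := ⟨hθ.1, by linarith [hθ.2]⟩
    have hbound : |cotSolve₂ m (truncSource a (ext w)) θ - cotSolve₂ m (truncSource a (ext w')) θ|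
        ≤ π / 2 * (a * dist w w' * (exp (K * θ) / K)) := by
      rw [cotSolve₂_sub m (hsrc w) (hsrc w') hθ']
      refine (abs_cotSolve₂_le m ((hsrc w).sub (hsrc w')) hθ).trans ?_
      have hintegral : ∫ r in (0:ℝ)..θ, |truncSource a (ext w) r - truncSource a (ext w') r|
          ≤ a * dist w w' * (exp (K * θ) / K) := by
        refine le_trans ?_ (mul_le_mul_of_nonneg_left (integral_exp_mul_le hK θ)
          (by positivity : 0 ≤ a * dist w w'))
        rw [← intervalIntegral.integral_const_mul]
        refine intervalIntegral.integral_mono_on hθ.1 ?_ ?_ ?_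
        · exact ((hsrc w).sub (hsrc w')).abs.intervalIntegrable _ _
        · exact Continuous.intervalIntegrable (by fun_prop) _ _
        · intro r hr
          refine (abs_truncSource_sub_le (by positivity : 0 ≤ a) _ _ r).trans ?_
          rw [sub_self, abs_zero, zero_add, mul_assoc]
          refine mul_le_mul_of_nonneg_left ?_ (by positivity)
          simp only [ext]
          rw [← mul_sub, abs_mul, abs_of_pos (exp_pos _), mul_comm]
          refine mul_le_mul_of_nonneg_right ?_ (exp_pos _).le
          exact ContinuousMap.dist_apply_le_dist (f := w) (g := w') (projIcc 0 (π / 2) hab r)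
      refine mul_le_mul hθ.2 hintegral ?_ hab
      exact intervalIntegral.integral_nonneg hθ.1 fun r _ => abs_nonneg _
    have hfin : exp (-(K * θ)) * (2 * m * (π / 2 * (a * dist w w' * (exp (K * θ) / K))))
        ≤ 1 / 2 * dist w w' := by
      have he : exp (-(K * θ)) * exp (K * θ) = 1 := by rw [← exp_add]; simp
      calc _ = (exp (-(K * θ)) * exp (K * θ)) * (m * π * a / K) * dist w w' := by
            field_simp
        _ = (m * π * a / K) * dist w w' := by rw [he, one_mul]
        _ ≤ 1 / 2 * dist w w' := by
            refine mul_le_mul_of_nonneg_right ?_ dist_nonneg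
            rw [div_le_iff₀ hK]
            linarith
    refine le_trans ?_ (hfin.trans (by norm_num))
    rw [Real.dist_eq]
    change |exp (-(K * θ)) * (-2 * m * cotSolve₂ m (truncSource a (ext w)) θ)
      - exp (-(K * θ)) * (-2 * m * cotSolve₂ m (truncSource a (ext w')) θ)| ≤ _
    rw [← mul_sub, ← mul_sub, abs_mul, abs_mul, abs_of_pos (exp_pos _),
      show |(-2 * (m:ℝ))| = 2 * m by rw [neg_mul, abs_neg, abs_of_nonneg (by positivity)]]
    gcongr
  set w := hΦ.fixedPoint Φ
  have hw : Φ w = w := hΦ.fixedPoint_isFixedPt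
  refine ⟨ext w, hext w, fun θ hθ => ?_⟩
  have h1 := DFunLike.congr_fun hw ⟨θ, hθ⟩
  change exp (-(K * θ)) * (-2 * m * cotSolve₂ m (truncSource a (ext w)) θ) = w ⟨θ, hθ⟩ at h1
  have h2 : ext w θ = exp (K * θ) * w ⟨θ, hθ⟩ := by
    simp only [ext, IccExtend_of_mem hab _ hθ]
  rw [h2, ← h1, ← mul_assoc, ← exp_add]
  simp

lemma le_mul_exp_of_le_add_integral {D : ℝ → ℝ} (hD : Continuous D) {ε K b : ℝ} (hK : 0 < K)
    (h : ∀ θ ∈ Icc 0 b, D θ ≤ ε + K * ∫ r in (0:ℝ)..θ, D r) {θ : ℝ} (hθ : θ ∈ Icc 0 b) :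
    D θ ≤ ε * exp (K * θ) := by
  let Q : ℝ → ℝ := fun x => exp (-(K * x)) * (ε + K * ∫ r in (0:ℝ)..x, D r)
  have hQ : ∀ x, HasDerivAt Q (K * exp (-(K * x)) * (D x - (ε + K * ∫ r in (0:ℝ)..x, D r))) x := by
    intro x
    have h1 : HasDerivAt (fun x => exp (-(K * x))) (exp (-(K * x)) * -(K * 1)) x :=
      (((hasDerivAt_id x).const_mul K).neg).exp
    have h2 := ((hD.integral_hasStrictDerivAt 0 x).hasDerivAt.const_mul K).const_add ε
    refine (h1.mul h2).congr_deriv ?_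
    ring
  have hanti : AntitoneOn Q (Icc 0 b) := by
    refine antitoneOn_of_deriv_nonpos (convex_Icc 0 b)
      (fun x _ => (hQ x).continuousAt.continuousWithinAt)
      (fun x _ => (hQ x).differentiableAt.differentiableWithinAt) fun x hx => ?_
    rw [interior_Icc] at hx
    rw [(hQ x).deriv]
    exact mul_nonpos_of_nonneg_of_nonpos (by positivity)
      (sub_nonpos.2 (h x (Ioo_subset_Icc_self hx)))
  have h0 := hanti ⟨le_rfl, hθ.1.trans hθ.2⟩ hθ hθ.1
  simp only [Q, mul_zero, neg_zero, exp_zero, intervalIntegral.integral_same, add_zero,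
    one_mul] at h0
  refine (h θ hθ).trans ?_
  rw [exp_neg, inv_mul_le_iff₀ (exp_pos _)] at h0
  linarith

lemma IsTruncSol.integral_abs_sub_le {m : ℕ} {a b : ℝ} {u v : ℝ → ℝ} (hu : IsTruncSol m a u)
    (hv : IsTruncSol m b v) (hb : 0 ≤ b) {θ : ℝ} (hθ : θ ∈ Icc 0 (π / 2)) :
    ∫ r in (0:ℝ)..θ, |truncSource a u r - truncSource b v r|
      ≤ θ * |a - b| + b * ∫ r in (0:ℝ)..θ, |u r - v r| := by
  have h1 := hu.continuous
  have h2 := hv.continuous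
  calc _ ≤ ∫ r in (0:ℝ)..θ, (|a - b| + b * |u r - v r|) := by
        refine intervalIntegral.integral_mono_on hθ.1 ?_ ?_ fun r _ =>
          abs_truncSource_sub_le hb u v r
        · exact ((continuous_truncSource a h1).sub
            (continuous_truncSource b h2)).abs.intervalIntegrable _ _
        · exact Continuous.intervalIntegrable (by fun_prop) _ _
    _ = _ := by
        rw [intervalIntegral.integral_add (by simp)
          (Continuous.intervalIntegrable (by fun_prop) _ _), intervalIntegral.integral_const_mul]
        simp

lemma IsTruncSol.abs_sub_le {m : ℕ} {a b B : ℝ} {u v : ℝ → ℝ} (hu : IsTruncSol m a u)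
    (hv : IsTruncSol m b v) (hb : 0 ≤ b) (hbB : b ≤ B) {θ : ℝ} (hθ : θ ∈ Icc 0 (π / 2)) :
    |u θ - v θ| ≤ 8 * m * exp (4 * m * B * 2 + 2) * |a - b| := by
  have hpi := pi_pos
  have hpi4 := pi_le_four
  have hB : 0 ≤ B := hb.trans hbB
  have h1 := hu.continuous
  have h2 := hv.continuous
  have hD : Continuous fun r => |u r - v r| := by fun_prop
  have key := le_mul_exp_of_le_add_integral hD (ε := 8 * m * |a - b|) (K := 4 * m * B + 1)
    (b := π / 2) (by positivity) ?_ hθ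
  · refine key.trans ?_
    have : exp ((4 * m * B + 1) * θ) ≤ exp (4 * m * B * 2 + 2) := by
      apply exp_le_exp.2
      have : θ ≤ 2 := by linarith [hθ.2]
      have : (4 * m * B + 1) * θ ≤ (4 * m * B + 1) * 2 :=
        mul_le_mul_of_nonneg_left this (by positivity)
      linarith
    calc _ ≤ 8 * m * |a - b| * exp (4 * m * B * 2 + 2) := by gcongr
      _ = _ := by ring
  · intro s hs
    have hs2 : s ≤ 2 := by linarith [hs.2]
    have hs' : s ∈ Ico 0 π := ⟨hs.1, by linarith [hs.2]⟩
    have hI : 0 ≤ ∫ r in (0:ℝ)..s, |u r - v r| :=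
      intervalIntegral.integral_nonneg hs.1 fun r _ => abs_nonneg _
    have hfc := continuous_truncSource a h1
    have hgc := continuous_truncSource b h2
    have e1 := abs_cotSolve₂_le m (hfc.sub hgc) hs
    have e2 := hu.integral_abs_sub_le hv hb hs
    rw [hu.eq s hs, hv.eq s hs, ← mul_sub, cotSolve₂_sub m hfc hgc hs', abs_mul,
      show |(-2 * (m:ℝ))| = 2 * m by rw [neg_mul, abs_neg, abs_of_nonneg (by positivity)]]
    calc _ ≤ 2 * m * (s * (s * |a - b| + b * ∫ r in (0:ℝ)..s, |u r - v r|)) := by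
          refine mul_le_mul_of_nonneg_left (e1.trans ?_) (by positivity)
          exact mul_le_mul_of_nonneg_left e2 hs.1
      _ ≤ 2 * m * (2 * (2 * |a - b| + B * ∫ r in (0:ℝ)..s, |u r - v r|)) := by
          have := hs.1
          gcongr
      _ ≤ _ := by nlinarith

/-- The pair `(u, u')` for a solution of `u'' + m cot(θ) u' + 2m (a eᵘ - 1) = 0` on `(0, π/2]`
that is regular at `0` with `u 0 = 0`. -/
structure IsRegSol (m : ℕ) (a : ℝ) (U P : ℝ → ℝ) : Prop where
  zero : U 0 = 0
  hasDerivAt_fst : ∀ θ ∈ Ioc 0 (π / 2), HasDerivAt U (P θ) θ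
  hasDerivAt_snd : ∀ θ ∈ Ioc 0 (π / 2),
    HasDerivAt P (-m * (cos θ / sin θ) * P θ - 2 * m * (a * exp (U θ) - 1)) θ
  nonpos : ∀ θ ∈ Icc 0 (π / 2), U θ ≤ 0
  abs_fst_le : ∀ θ ∈ Icc 0 (π / 2), |U θ| ≤ 2 * m * a * θ ^ 2
  abs_snd_le : ∀ θ ∈ Icc 0 (π / 2), |P θ| ≤ 2 * m * a * θ
  continuousOn_fst : ContinuousOn U (Icc 0 (π / 2))
  continuousOn_snd : ContinuousOn P (Icc 0 (π / 2))

lemma abs_neg_two_mul_natCast (m : ℕ) : |(-2 * (m:ℝ))| = 2 * m := by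
  rw [neg_mul, abs_neg, abs_of_nonneg (by positivity)]

lemma integral_abs_truncSource_le {a : ℝ} (ha : 1 ≤ a) {u : ℝ → ℝ} (hu : Continuous u) {θ : ℝ}
    (hθ : 0 ≤ θ) : ∫ r in (0:ℝ)..θ, |truncSource a u r| ≤ a * θ := by
  calc _ ≤ ∫ r in (0:ℝ)..θ, a :=
        intervalIntegral.integral_mono_on hθ
          ((continuous_truncSource a hu).abs.intervalIntegrable _ _) (by simp)
          fun r _ => abs_truncSource_le ha u r
    _ = _ := by simp [mul_comm]

lemma IsTruncSol.nonpos {m : ℕ} (hm : m ≠ 0) {a : ℝ} (ha : 1 < a) {u : ℝ → ℝ}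
    (hu : IsTruncSol m a u) {θ : ℝ} (hθ : θ ∈ Icc 0 (π / 2)) : u θ ≤ 0 := by
  have hpi := pi_pos
  have huc := hu.continuous
  have hgc := continuous_truncSource a huc
  have hm0 : (0:ℝ) < m := by positivity
  set H : ℝ → ℝ := fun x => ∫ s in (0:ℝ)..x, exp (min s 0) with hHdef
  have hH : ∀ x, HasDerivAt H (exp (min x 0)) x := fun x =>
    ((by fun_prop : Continuous fun s : ℝ => exp (min s 0)).integral_hasStrictDerivAt 0 x).hasDerivAt
  set P : ℝ → ℝ := fun x => -2 * m * cotSolve m (truncSource a u) x with hPdef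
  set U : ℝ → ℝ := fun x => -2 * m * cotSolve₂ m (truncSource a u) x with hUdef
  let E : ℝ → ℝ := fun x => P x ^ 2 / 2 + 2 * m * (a * H (U x) - U x)
  have hUc : ContinuousOn U (Icc 0 (π / 2)) :=
    continuousOn_const.mul (continuousOn_cotSolve₂ m hgc)
  have hPc : ContinuousOn P (Icc 0 (π / 2)) :=
    continuousOn_const.mul ((continuousOn_cotSolve m hgc).mono
      (Icc_subset_Ico_right (by linarith)))
  have hHc : Continuous H := continuous_iff_continuousAt.2 fun x => (hH x).continuousAt
  have hE : ∀ x ∈ Ioo 0 (π / 2), HasDerivAt E (-(m * (cos x / sin x) * P x ^ 2)) x := by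
    intro x hx
    have hx' : x ∈ Ioo 0 π := ⟨hx.1, by linarith [hx.2]⟩
    have hP' := (hasDerivAt_cotSolve m hgc hx').const_mul (-2 * (m:ℝ))
    have hU' : HasDerivAt U (P x) x := (hasDerivAt_cotSolve₂ m hgc hx').const_mul (-2 * (m:ℝ))
    have h1 := ((hP'.fun_pow 2).div_const 2).add
      (((((hH (U x)).comp x hU').const_mul a).sub hU').const_mul (2 * (m:ℝ)))
    refine h1.congr_deriv ?_
    have h2 : truncSource a u x = a * exp (min (U x) 0) - 1 := by
      rw [truncSource, hu.eq x (Ioo_subset_Icc_self hx)]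
    rw [h2]
    simp only [hPdef]
    ring
  have hanti : AntitoneOn E (Icc 0 (π / 2)) := by
    refine antitoneOn_of_deriv_nonpos (convex_Icc _ _) ?_ ?_ ?_
    · exact ((hPc.pow 2).div_const 2).add (continuousOn_const.mul
        ((continuousOn_const.mul (hHc.comp_continuousOn hUc)).sub hUc))
    · rw [interior_Icc]
      exact fun x hx => (hE x hx).differentiableAt.differentiableWithinAt
    · rw [interior_Icc]
      intro x hx
      rw [(hE x hx).deriv, neg_nonpos]
      have h1 := sin_pos_of_pos_of_lt_pi hx.1 (by linarith [hx.2])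
      have h2 := cos_pos_of_mem_Ioo ⟨by linarith [hx.1], hx.2⟩
      positivity
  have hle := hanti ⟨le_rfl, by positivity⟩ hθ hθ.1
  have hU0 : U 0 = 0 := by simp [hUdef, cotSolve₂]
  have hP0 : P 0 = 0 := by simp [hPdef, cotSolve_zero]
  have hH0 : H 0 = 0 := by simp [hHdef]
  simp only [E, hU0, hP0, hH0] at hle
  rw [hu.eq θ hθ]
  change U θ ≤ 0
  by_contra! hpos
  have hHU : H (U θ) = U θ := by
    have : H (U θ) = ∫ s in (0:ℝ)..U θ, (1:ℝ) := by
      refine intervalIntegral.integral_congr fun s hs => ?_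
      rw [uIcc_of_le hpos.le] at hs
      simp [min_eq_right hs.1]
    simpa using this
  rw [hHU] at hle
  have : 0 < 2 * m * (a * U θ - U θ) := by
    have : 0 < (a - 1) * U θ := mul_pos (by linarith) hpos
    have : 0 < 2 * m * ((a - 1) * U θ) := by positivity
    linarith
  nlinarith [sq_nonneg (P θ)]

lemma IsTruncSol.isRegSol {m : ℕ} (hm : m ≠ 0) {a : ℝ} (ha : 1 < a) {u : ℝ → ℝ}
    (hu : IsTruncSol m a u) :
    IsRegSol m a (fun θ => -2 * m * cotSolve₂ m (truncSource a u) θ)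
      (fun θ => -2 * m * cotSolve m (truncSource a u) θ) := by
  have hpi := pi_pos
  have huc := hu.continuous
  have hgc := continuous_truncSource a huc
  refine ⟨by simp [cotSolve₂], fun θ hθ => ?_, fun θ hθ => ?_, fun θ hθ => ?_, fun θ hθ => ?_,
    fun θ hθ => ?_, ?_, ?_⟩
  · exact (hasDerivAt_cotSolve₂ m hgc ⟨hθ.1, by linarith [hθ.2]⟩).const_mul _
  · refine ((hasDerivAt_cotSolve m hgc ⟨hθ.1, by linarith [hθ.2]⟩).const_mul _).congr_deriv ?_
    rw [← hu.eq θ (Ioc_subset_Icc_self hθ), truncSource,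
      min_eq_left (hu.nonpos hm ha (Ioc_subset_Icc_self hθ))]
    ring
  · exact (hu.eq θ hθ).symm.trans_le (hu.nonpos hm ha hθ)
  · rw [abs_mul, abs_neg_two_mul_natCast]
    calc _ ≤ 2 * m * (θ * (a * θ)) := by
          refine mul_le_mul_of_nonneg_left ((abs_cotSolve₂_le m hgc hθ).trans ?_) (by positivity)
          exact mul_le_mul_of_nonneg_left (integral_abs_truncSource_le ha.le huc hθ.1) hθ.1
      _ = _ := by ring
  · rw [abs_mul, abs_neg_two_mul_natCast]
    calc _ ≤ 2 * m * (a * θ) := by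
          refine mul_le_mul_of_nonneg_left ((abs_cotSolve_le m hgc hθ).trans ?_) (by positivity)
          exact integral_abs_truncSource_le ha.le huc hθ.1
      _ = _ := by ring
  · exact continuousOn_const.mul (continuousOn_cotSolve₂ m hgc)
  · exact continuousOn_const.mul ((continuousOn_cotSolve m hgc).mono
      (Icc_subset_Ico_right (by linarith)))

lemma IsTruncSol.abs_snd_sub_le {m : ℕ} {a b B : ℝ} {u v : ℝ → ℝ} (hu : IsTruncSol m a u)
    (hv : IsTruncSol m b v) (hb : 0 ≤ b) (hbB : b ≤ B) {θ : ℝ} (hθ : θ ∈ Icc 0 (π / 2)) :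
    |-2 * m * cotSolve m (truncSource a u) θ - -2 * m * cotSolve m (truncSource b v) θ|
      ≤ 2 * m * (2 + 2 * B * (8 * m * exp (4 * m * B * 2 + 2))) * |a - b| := by
  have hpi4 := pi_le_four
  have hB : 0 ≤ B := hb.trans hbB
  have hfc := continuous_truncSource a hu.continuous
  have hgc := continuous_truncSource b hv.continuous
  have h1 := hu.continuous
  have h2 := hv.continuous
  have hθ0 := hθ.1
  have hθ2 : θ ≤ 2 := by linarith [hθ.2]
  set C := 8 * m * exp (4 * m * B * 2 + 2)
  have hC : 0 ≤ C := by positivity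
  have hI : ∫ r in (0:ℝ)..θ, |u r - v r| ≤ C * |a - b| * θ := by
    calc _ ≤ ∫ r in (0:ℝ)..θ, C * |a - b| :=
          intervalIntegral.integral_mono_on hθ.1
            (Continuous.intervalIntegrable (by fun_prop) _ _) (by simp)
            fun r hr => hu.abs_sub_le hv hb hbB ⟨hr.1, hr.2.trans hθ.2⟩
      _ = _ := by rw [intervalIntegral.integral_const, sub_zero, smul_eq_mul, mul_comm]
  rw [← mul_sub, cotSolve_sub m hfc hgc, abs_mul, abs_neg_two_mul_natCast, mul_assoc (2 * (m:ℝ))]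
  refine mul_le_mul_of_nonneg_left ?_ (by positivity)
  refine (abs_cotSolve_le m (hfc.sub hgc) hθ).trans ((hu.integral_abs_sub_le hv hb hθ).trans ?_)
  calc _ ≤ θ * |a - b| + b * (C * |a - b| * θ) := by gcongr
    _ ≤ 2 * |a - b| + B * (C * |a - b| * 2) := by gcongr
    _ = _ := by ring

theorem exists_isRegSol_family {m : ℕ} (hm : m ≠ 0) :
    ∃ U P : ℝ → ℝ → ℝ, (∀ a, 2 ≤ a → IsRegSol m a (U a) (P a)) ∧
      ∀ B, ContinuousOn (fun x : ℝ × ℝ => U x.1 x.2) (Icc 2 B ×ˢ Icc 0 (π / 2)) ∧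
        ContinuousOn (fun x : ℝ × ℝ => P x.1 x.2) (Icc 2 B ×ˢ Icc 0 (π / 2)) := by
  have hex : ∀ a : ℝ, ∃ u, 2 ≤ a → IsTruncSol m a u := by
    intro a
    by_cases ha : 2 ≤ a
    · obtain ⟨u, hu⟩ := exists_isTruncSol m (by linarith : (1:ℝ) ≤ a)
      exact ⟨u, fun _ => hu⟩
    · exact ⟨0, fun h => absurd h ha⟩
  choose u hu using hex
  have hreg := fun a (ha : 2 ≤ a) => (hu a ha).isRegSol hm (by linarith)
  refine ⟨_, _, hreg, fun B => ?_⟩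
  constructor
  · refine continuousOn_prod_of_continuousOn_lipschitzOnWith _
      (Real.toNNReal (8 * m * exp (4 * m * B * 2 + 2)))
      (fun a ha => (hreg a ha.1).continuousOn_fst) fun θ hθ => ?_
    refine LipschitzOnWith.of_dist_le_mul fun a ha b hb => ?_
    rw [Real.dist_eq, Real.dist_eq, Real.coe_toNNReal _ (by positivity)]
    simp only
    rw [← (hu a ha.1).eq θ hθ, ← (hu b hb.1).eq θ hθ]
    exact (hu a ha.1).abs_sub_le (hu b hb.1) (by linarith [hb.1]) hb.2 hθ
  · rcases lt_or_ge B 2 with hB | hB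
    · simp [Icc_eq_empty (not_le.2 hB)]
    refine continuousOn_prod_of_continuousOn_lipschitzOnWith _
      (Real.toNNReal (2 * m * (2 + 2 * B * (8 * m * exp (4 * m * B * 2 + 2)))))
      (fun a ha => (hreg a ha.1).continuousOn_snd) fun θ hθ => ?_
    refine LipschitzOnWith.of_dist_le_mul fun a ha b hb => ?_
    rw [Real.dist_eq, Real.dist_eq, Real.coe_toNNReal _ (by positivity)]
    exact (hu a ha.1).abs_snd_sub_le (hu b hb.1) (by linarith [hb.1]) hb.2 hθ

/-- The equation `w_tt - c tanh(t) w_t + 2c (e^w - 1) = 0` on `[δ, π/2]`, written as a system for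
`(w, y) = (w, w_t)` in the variable `θ = 2 arctan (e^t)`. -/
structure IsCylSol (c δ : ℝ) (w y : ℝ → ℝ) : Prop where
  hasDerivAt_fst : ∀ θ ∈ Icc δ (π / 2), HasDerivAt w (y θ / sin θ) θ
  hasDerivAt_snd : ∀ θ ∈ Icc δ (π / 2),
    HasDerivAt y ((-c * cos θ * y θ - 2 * c * (exp (w θ) - 1)) / sin θ) θ

/-- The energy of a solution of `IsCylSol`. -/
noncomputable def cylEnergy (c w y : ℝ) : ℝ := y ^ 2 / 2 + 2 * c * (exp w - 1 - w)

/-- The angular velocity of `(w, y)` along solutions of `IsCylSol`. -/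
noncomputable def angularRate (c w y θ : ℝ) : ℝ :=
  -(y ^ 2 + c * cos θ * w * y + 2 * c * (w * (exp w - 1))) / (sin θ * (w ^ 2 + y ^ 2))

/-- The continuous angle of `(w, y)` modulo `π`, normalised to lie in `(-π/2, π/2)` at `δ`. -/
noncomputable def phase (c δ : ℝ) (w y : ℝ → ℝ) (θ : ℝ) : ℝ :=
  arctan (y δ / w δ) + ∫ s in δ..θ, angularRate c (w s) (y s) s

lemma sin_pos_of_mem_Icc {δ θ : ℝ} (hδ : 0 < δ) (hθ : θ ∈ Icc δ (π / 2)) : 0 < sin θ :=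
  sin_pos_of_pos_of_lt_pi (hδ.trans_le hθ.1) (by linarith [hθ.2, pi_pos])

lemma cos_nonneg_of_mem_Icc_of_pos {δ θ : ℝ} (hδ : 0 < δ) (hθ : θ ∈ Icc δ (π / 2)) :
    0 ≤ cos θ :=
  cos_nonneg_of_mem_Icc ⟨by linarith [hθ.1, pi_pos], hθ.2⟩

lemma mul_exp_sub_one_ge {w M : ℝ} (hw : -M ≤ w) (hM : 0 ≤ M) :
    exp (-M) * w ^ 2 ≤ w * (exp w - 1) := by
  have h1 : exp (-M) ≤ 1 := exp_le_one_iff.2 (by linarith)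
  rcases le_total 0 w with h | h
  · have := add_one_le_exp w
    nlinarith [mul_nonneg h h, mul_le_mul_of_nonneg_right h1 (sq_nonneg w)]
  · have h2 : exp (-M) ≤ exp w := exp_le_exp.2 hw
    have h3 := add_one_le_exp (-w)
    have h4 : exp w * exp (-w) = 1 := by rw [← exp_add]; simp
    have h5 : exp w - 1 ≤ w * exp w := by nlinarith [exp_pos w]
    nlinarith [mul_le_mul_of_nonneg_right h2 (sq_nonneg w)]

lemma mul_exp_sub_one_ge_sub_pow (w : ℝ) :
    19 / 20 * w ^ 2 - 5 * w ^ 4 ≤ w * (exp w - 1) := by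
  have h1 := add_one_le_exp w
  rcases le_total 0 w with h | h
  · nlinarith [mul_nonneg h h, sq_nonneg (w ^ 2)]
  · have h3 := add_one_le_exp (-w)
    have h4 : exp w * exp (-w) = 1 := by rw [← exp_add]; simp
    have h5 : exp w - 1 ≤ w * exp w := by nlinarith [exp_pos w]
    have h6 : w ^ 2 * (1 + w) ≤ w * (exp w - 1) := by
      have h7 : w ^ 2 * (1 + w) ≤ w ^ 2 * exp w := by
        apply mul_le_mul_of_nonneg_left _ (sq_nonneg w); linarith
      nlinarith
    nlinarith [sq_nonneg (w * (w + 1 / 10)), sq_nonneg w]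

lemma quadratic_form_ge {c τ : ℝ} (hc : 1 ≤ c) (hc' : c ≤ 7) (hτ : 0 ≤ τ) (hτ' : τ ≤ 1)
    (w y : ℝ) :
    1 / 20 * (w ^ 2 + y ^ 2) ≤ y ^ 2 + c * τ * w * y + 19 / 10 * c * w ^ 2 := by
  have h1 : (c * τ) ^ 2 ≤ c ^ 2 := by
    have : c * τ ≤ c := by nlinarith
    have : 0 ≤ c * τ := by positivity
    nlinarith
  have h2 : c ^ 2 ≤ 4 * (19 / 20) * (19 / 10 * c - 1 / 20) := by nlinarith
  have h3 : 0 ≤ (19 / 20 * y + c * τ * w / 2) ^ 2 := sq_nonneg _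
  nlinarith [sq_nonneg w, mul_le_mul_of_nonneg_right (h1.trans h2) (sq_nonneg w)]

lemma sq_add_sq_le_of_cylEnergy_le {c w y E₀ : ℝ} (hc : 1 ≤ c)
    (h : cylEnergy c w y ≤ E₀) : |w| ≤ E₀ + 1 ∧ y ^ 2 ≤ 2 * E₀ := by
  have h1 : 0 ≤ exp w - 1 - w := by linarith [add_one_le_exp w]
  have h2 : exp w - 1 - w ≤ c * (exp w - 1 - w) := le_mul_of_one_le_left h1 hc
  rw [cylEnergy] at h
  have hE : 0 ≤ E₀ := by nlinarith [sq_nonneg y]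
  refine ⟨abs_le.2 ⟨?_, ?_⟩, by nlinarith⟩
  · nlinarith [exp_pos w, sq_nonneg y]
  · rcases le_total w 0 with hw | hw
    · linarith
    · have h3 := quadratic_le_exp_of_nonneg hw
      nlinarith [sq_nonneg y, sq_nonneg (w - 1)]

namespace IsCylSol

variable {c δ : ℝ} {w y : ℝ → ℝ}

lemma continuousOn_fst (h : IsCylSol c δ w y) : ContinuousOn w (Icc δ (π / 2)) :=
  fun θ hθ => (h.hasDerivAt_fst θ hθ).continuousAt.continuousWithinAt

lemma continuousOn_snd (h : IsCylSol c δ w y) : ContinuousOn y (Icc δ (π / 2)) :=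
  fun θ hθ => (h.hasDerivAt_snd θ hθ).continuousAt.continuousWithinAt

lemma hasDerivAt_cylEnergy (h : IsCylSol c δ w y) {θ : ℝ} (hθ : θ ∈ Icc δ (π / 2)) :
    HasDerivAt (fun θ => cylEnergy c (w θ) (y θ)) (-(c * cos θ * y θ ^ 2) / sin θ) θ := by
  have h1 := h.hasDerivAt_fst θ hθ
  have h2 := h.hasDerivAt_snd θ hθ
  refine (((h2.fun_pow 2).div_const 2).add
    (((h1.exp.sub_const 1).sub h1).const_mul (2 * c))).congr_deriv ?_
  ring

lemma antitoneOn_cylEnergy (h : IsCylSol c δ w y) (hδ : 0 < δ) (hc : 0 ≤ c) :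
    AntitoneOn (fun θ => cylEnergy c (w θ) (y θ)) (Icc δ (π / 2)) := by
  refine antitoneOn_of_deriv_nonpos (convex_Icc _ _)
    (fun θ hθ => (h.hasDerivAt_cylEnergy hθ).continuousAt.continuousWithinAt)
    (fun θ hθ => (h.hasDerivAt_cylEnergy
      (interior_subset hθ)).differentiableAt.differentiableWithinAt) fun θ hθ => ?_
  have hθ' := interior_subset hθ
  rw [(h.hasDerivAt_cylEnergy hθ').deriv]
  have h1 := sin_pos_of_mem_Icc hδ hθ'
  have h2 := cos_nonneg_of_mem_Icc_of_pos hδ hθ'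
  exact div_nonpos_of_nonpos_of_nonneg (neg_nonpos.2 (by positivity)) h1.le

lemma sq_add_sq_pos (h : IsCylSol c δ w y) (hδ : 0 < δ) (hc : 1 ≤ c) (hw : w δ ≠ 0)
    {θ : ℝ} (hθ : θ ∈ Icc δ (π / 2)) : 0 < w θ ^ 2 + y θ ^ 2 := by
  have hδm : δ ∈ Icc δ (π / 2) := ⟨le_rfl, hθ.1.trans hθ.2⟩
  set M := cylEnergy c (w δ) (y δ) + 1
  have hM : ∀ x ∈ Icc δ (π / 2), |w x| ≤ M := fun x hx =>
    (sq_add_sq_le_of_cylEnergy_le hc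
      (h.antitoneOn_cylEnergy hδ (by linarith) hδm hx hx.1)).1
  have hsδ := sin_pos_of_mem_Icc hδ hδm
  have hM0 : 0 ≤ M := (abs_nonneg _).trans (hM δ hδm)
  set L := (1 + 4 * c + 2 * c * exp M) / sin δ
  let Q : ℝ → ℝ := fun x => (w x ^ 2 + y x ^ 2) * exp (L * x)
  have hQ : ∀ x ∈ Icc δ (π / 2), HasDerivAt Q (((2 * w x * y x + 2 * y x *
      (-c * cos x * y x - 2 * c * (exp (w x) - 1))) / sin x + L * (w x ^ 2 + y x ^ 2))
        * exp (L * x)) x := by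
    intro x hx
    have h1 := h.hasDerivAt_fst x hx
    have h2 := h.hasDerivAt_snd x hx
    refine (((h1.fun_pow 2).add (h2.fun_pow 2)).mul
      ((hasDerivAt_id x).const_mul L).exp).congr_deriv ?_
    simp only [id, Pi.add_apply]
    push_cast
    ring
  have hmono : MonotoneOn Q (Icc δ (π / 2)) := by
    refine monotoneOn_of_deriv_nonneg (convex_Icc _ _)
      (fun x hx => (hQ x hx).continuousAt.continuousWithinAt)
      (fun x hx => (hQ x (interior_subset hx)).differentiableAt.differentiableWithinAt)
      fun x hx => ?_
    have hx' := interior_subset hx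
    rw [(hQ x hx').deriv]
    refine mul_nonneg ?_ (exp_pos _).le
    have hs := sin_pos_of_mem_Icc hδ hx'
    have hss : sin δ ≤ sin x :=
      sin_le_sin_of_le_of_le_pi_div_two (by linarith [pi_pos]) hx'.2 hx'.1
    have hL : (1 + 4 * c + 2 * c * exp M) / sin x ≤ L :=
      div_le_div_of_nonneg_left (by positivity) hsδ hss
    have hL2 := mul_le_mul_of_nonneg_right hL
      (by positivity : 0 ≤ w x ^ 2 + y x ^ 2)
    refine le_trans ?_ (add_le_add_right hL2 _)
    rw [div_mul_eq_mul_div, ← add_div]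
    refine div_nonneg ?_ hs.le
    have hg : |exp (w x) - 1| ≤ exp M * |w x| := by
      have hwM := abs_le.1 (hM x hx')
      have h1 := add_one_le_exp (w x)
      have h2 := add_one_le_exp (-w x)
      have h3 : exp (w x) * exp (-w x) = 1 := by rw [← exp_add]; simp
      have h4 : exp (w x) ≤ exp M := exp_le_exp.2 hwM.2
      have h5 : exp (w x) - 1 ≤ exp (w x) * w x := by nlinarith [exp_pos (w x)]
      have h6 : 1 ≤ exp M := one_le_exp hM0
      rw [abs_le]
      constructor
      · nlinarith [neg_abs_le (w x), abs_nonneg (w x)]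
      · calc _ ≤ exp (w x) * w x := h5
          _ ≤ exp (w x) * |w x| := by gcongr; exact le_abs_self _
          _ ≤ _ := by gcongr
    have hyg : |y x * (exp (w x) - 1)| ≤ exp M * ((w x ^ 2 + y x ^ 2) / 2) := by
      rw [abs_mul]
      calc _ ≤ |y x| * (exp M * |w x|) := by gcongr
        _ = exp M * (|y x| * |w x|) := by ring
        _ ≤ _ := by
          gcongr
          nlinarith [sq_nonneg (|y x| - |w x|), sq_abs (y x), sq_abs (w x)]
    have hcos : cos x * y x ^ 2 ≤ y x ^ 2 := by nlinarith [cos_le_one x, sq_nonneg (y x)]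
    have hyg' := (abs_le.1 hyg).2
    have hc1 : c * (cos x * y x ^ 2) ≤ c * y x ^ 2 := by gcongr
    have hc2 : c * (y x * (exp (w x) - 1)) ≤ c * (exp M * ((w x ^ 2 + y x ^ 2) / 2)) := by
      gcongr
    have hc3 : 0 ≤ c * w x ^ 2 := by positivity
    have hc4 : 0 ≤ c * y x ^ 2 := by positivity
    nlinarith [sq_nonneg (w x + y x)]
  have h1 := hmono hδm hθ hθ.1
  have h2 : 0 < Q δ := by
    have : 0 < w δ ^ 2 := by positivity
    have : 0 ≤ y δ ^ 2 := sq_nonneg _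
    exact mul_pos (by linarith) (exp_pos _)
  exact pos_of_mul_pos_left (h2.trans_le h1) (exp_pos _).le

lemma continuousOn_angularRate (h : IsCylSol c δ w y) (hδ : 0 < δ) (hc : 1 ≤ c)
    (hw : w δ ≠ 0) :
    ContinuousOn (fun s => angularRate c (w s) (y s) s) (Icc δ (π / 2)) := by
  have h1 := h.continuousOn_fst
  have h2 := h.continuousOn_snd
  unfold angularRate
  refine ContinuousOn.div (by fun_prop) (by fun_prop) fun θ hθ => ?_
  exact (mul_pos (sin_pos_of_mem_Icc hδ hθ) (h.sq_add_sq_pos hδ hc hw hθ)).ne'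

lemma continuousOn_phase (h : IsCylSol c δ w y) (hδ : 0 < δ) (hδ' : δ ≤ π / 2) (hc : 1 ≤ c)
    (hw : w δ ≠ 0) : ContinuousOn (phase c δ w y) (Icc δ (π / 2)) := by
  have := intervalIntegral.continuousOn_primitive_interval (μ := MeasureTheory.volume)
    (f := fun s => angularRate c (w s) (y s) s) (a := δ) (b := π / 2) ?_
  · rw [uIcc_of_le hδ'] at this
    exact continuousOn_const.add this
  · rw [uIcc_of_le hδ']
    exact (h.continuousOn_angularRate hδ hc hw).integrableOn_Icc

lemma hasDerivAt_phase (h : IsCylSol c δ w y) (hδ : 0 < δ) (hc : 1 ≤ c)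
    (hw : w δ ≠ 0) {θ : ℝ} (hθ : θ ∈ Ioo δ (π / 2)) :
    HasDerivAt (phase c δ w y) (angularRate c (w θ) (y θ) θ) θ := by
  have hcont := h.continuousOn_angularRate hδ hc hw
  refine HasDerivAt.const_add _ (intervalIntegral.integral_hasDerivAt_right ?_ ?_ ?_)
  · refine (hcont.mono ?_).intervalIntegrable
    rw [uIcc_of_le hθ.1.le]
    exact Icc_subset_Icc_right hθ.2.le
  · exact (hcont.mono Ioo_subset_Icc_self).stronglyMeasurableAtFilter isOpen_Ioo θ hθ
  · exact hcont.continuousAt (Icc_mem_nhds hθ.1 hθ.2)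

lemma mul_sin_phase_eq (h : IsCylSol c δ w y) (hδ : 0 < δ) (hc : 1 ≤ c)
    (hw : w δ ≠ 0) {θ : ℝ} (hθ : θ ∈ Icc δ (π / 2)) :
    w θ * sin (phase c δ w y θ) = y θ * cos (phase c δ w y θ) := by
  have hδ' := hθ.1.trans hθ.2
  have hδm : δ ∈ Icc δ (π / 2) := ⟨le_rfl, hδ'⟩
  set α := phase c δ w y with hα
  let Q : ℝ → ℝ := fun x => (w x * sin (α x) - y x * cos (α x)) ^ 2 / (w x ^ 2 + y x ^ 2)
  have hαc := h.continuousOn_phase hδ hδ' hc hw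
  have hwc := h.continuousOn_fst
  have hyc := h.continuousOn_snd
  have hQc : ContinuousOn Q (Icc δ (π / 2)) := by
    refine ContinuousOn.div ?_ (by fun_prop) fun x hx => (h.sq_add_sq_pos hδ hc hw hx).ne'
    have h1 : ContinuousOn (fun x => sin (α x)) (Icc δ (π / 2)) :=
      continuous_sin.comp_continuousOn hαc
    have h2 : ContinuousOn (fun x => cos (α x)) (Icc δ (π / 2)) :=
      continuous_cos.comp_continuousOn hαc
    fun_prop
  have hQ' : ∀ x ∈ Ioo δ (π / 2), HasDerivAt Q 0 x := by
    intro x hx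
    have hx' := Ioo_subset_Icc_self hx
    have hs := (sin_pos_of_mem_Icc hδ hx').ne'
    have hr := (h.sq_add_sq_pos hδ hc hw hx').ne'
    have h1 := h.hasDerivAt_fst x hx'
    have h2 := h.hasDerivAt_snd x hx'
    have h3 := h.hasDerivAt_phase hδ hc hw hx
    refine ((((h1.mul h3.sin).sub (h2.mul h3.cos)).fun_pow 2).div
      ((h1.fun_pow 2).add (h2.fun_pow 2)) hr).congr_deriv ?_
    rw [angularRate]
    simp only [← hα]
    simp only [Pi.sub_apply, Pi.mul_apply, Pi.add_apply, Nat.cast_ofNat,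
      Nat.add_one_sub_one, pow_one]
    field_simp
    ring
  have hconst : Q θ = Q δ := by
    have hd : DifferentiableOn ℝ Q (Ioo δ (π / 2)) := fun x hx =>
      (hQ' x hx).differentiableAt.differentiableWithinAt
    have ha : AntitoneOn Q (Icc δ (π / 2)) := by
      refine antitoneOn_of_deriv_nonpos (convex_Icc _ _) hQc (by rwa [interior_Icc])
        fun x hx => ?_
      rw [interior_Icc] at hx
      exact (hQ' x hx).deriv.le
    have hm : MonotoneOn Q (Icc δ (π / 2)) := by
      refine monotoneOn_of_deriv_nonneg (convex_Icc _ _) hQc (by rwa [interior_Icc])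
        fun x hx => ?_
      rw [interior_Icc] at hx
      exact (hQ' x hx).deriv.ge
    exact le_antisymm (ha hδm hθ hθ.1) (hm hδm hθ hθ.1)
  have hQδ : Q δ = 0 := by
    have : α δ = arctan (y δ / w δ) := by simp [hα, phase]
    simp only [Q, this, sin_arctan, cos_arctan]
    field_simp
    simp
  rw [hQδ] at hconst
  have hr := (h.sq_add_sq_pos hδ hc hw hθ).ne'
  have := (div_eq_zero_iff.1 hconst).resolve_right hr
  exact sub_eq_zero.1 (pow_eq_zero_iff (two_ne_zero) |>.1 this)

lemma angularRate_le (hc : 0 ≤ c) (w y : ℝ) {θ : ℝ} (hs : 0 < sin θ) (hcos : 0 ≤ cos θ)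
    (hr : 0 < w ^ 2 + y ^ 2) : angularRate c w y θ ≤ c / sin θ := by
  rw [angularRate, div_le_div_iff₀ (by positivity) hs]
  have h1 : 0 ≤ w * (exp w - 1) := by
    rcases le_total 0 w with h | h
    · exact mul_nonneg h (by linarith [one_le_exp h])
    · exact mul_nonneg_of_nonpos_of_nonpos h (by linarith [exp_le_one_iff.2 h])
  have h2 : 0 ≤ c * (w ^ 2 + y ^ 2 + cos θ * w * y) := by
    refine mul_nonneg hc ?_
    nlinarith [sq_nonneg (w + cos θ * y), sq_nonneg w, sq_nonneg y, cos_le_one θ,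
      mul_nonneg hcos (sub_nonneg.2 (cos_le_one θ)), sq_nonneg (cos θ * y),
      mul_le_mul_of_nonneg_right (by nlinarith [cos_le_one θ] : cos θ ^ 2 ≤ 1) (sq_nonneg y)]
  have h3 : 0 ≤ c * (w * (exp w - 1)) := mul_nonneg hc h1
  have h4 : -(y ^ 2 + c * cos θ * w * y + 2 * c * (w * (exp w - 1))) ≤ c * (w ^ 2 + y ^ 2) := by
    nlinarith [sq_nonneg y]
  nlinarith

lemma angularRate_le_of_sq (hc : 1 ≤ c) (hc' : c ≤ 7) (w y : ℝ) {θ : ℝ} (hs : 0 < sin θ)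
    (hcos : 0 ≤ cos θ) (hr : 0 < w ^ 2 + y ^ 2) :
    angularRate c w y θ ≤ (-(1 / 20) + 10 * c * w ^ 2) / sin θ := by
  rw [angularRate, div_le_div_iff₀ (by positivity) hs]
  have h1 := quadratic_form_ge hc hc' hcos (cos_le_one θ) w y
  have h2 := mul_le_mul_of_nonneg_left (mul_exp_sub_one_ge_sub_pow w) (by linarith : 0 ≤ 2 * c)
  have h3 : 0 ≤ c * (w ^ 2 * y ^ 2) := by positivity
  have h4 : -(y ^ 2 + c * cos θ * w * y + 2 * c * (w * (exp w - 1)))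
      ≤ (-(1 / 20) + 10 * c * w ^ 2) * (w ^ 2 + y ^ 2) := by
    nlinarith
  nlinarith

/-- On `[δ, π/3]` the rotation is at least linear in `log θ`, up to terms controlled by the
energy. -/
lemma phase_pi_div_three_le (h : IsCylSol c δ w y) (hδ : 0 < δ) (hδ' : δ ≤ π / 3) (hc : 1 ≤ c)
    (hc' : c ≤ 7) (hw : w δ ≠ 0) {E₀ : ℝ} (hE : cylEnergy c (w δ) (y δ) ≤ E₀) {C₁ C₂ : ℝ}
    (hC₂ : C₂ = 10 * exp (E₀ + 1)) (hC₁ : C₁ = 2 * C₂ + C₂ ^ 2 / 20) :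
    phase c δ w y (π / 3)
      ≤ π / 2 + C₁ * E₀ + C₂ * ((E₀ + 1) ^ 2 + 2 * E₀) + 1 / 20 * log δ := by
  have hpi := pi_pos
  have hδm : δ ∈ Icc δ (π / 2) := ⟨le_rfl, by linarith⟩
  have hsub : Icc δ (π / 3) ⊆ Icc δ (π / 2) := Icc_subset_Icc_right (by linarith)
  have hbd : ∀ θ ∈ Icc δ (π / 2), |w θ| ≤ E₀ + 1 ∧ y θ ^ 2 ≤ 2 * E₀ := fun θ hθ =>
    sq_add_sq_le_of_cylEnergy_le hc
      ((h.antitoneOn_cylEnergy hδ (by linarith) hδm hθ hθ.1).trans hE)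
  have hM : 0 ≤ E₀ + 1 := (abs_nonneg _).trans (hbd δ hδm).1
  have hE0 : 0 ≤ E₀ := by nlinarith [(hbd δ hδm).2, sq_nonneg (y δ)]
  have hC₂0 : 0 < C₂ := by rw [hC₂]; positivity
  have hC₁0 : 0 < C₁ := by rw [hC₁]; positivity
  have hprod : ∀ θ ∈ Icc δ (π / 2), |w θ * y θ| ≤ ((E₀ + 1) ^ 2 + 2 * E₀) / 2 := by
    intro θ hθ
    obtain ⟨h1, h2⟩ := hbd θ hθ
    have h3 : w θ ^ 2 ≤ (E₀ + 1) ^ 2 := sq_le_sq' (abs_le.1 h1).1 (abs_le.1 h1).2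
    rw [abs_le]
    constructor <;> nlinarith [sq_nonneg (w θ + y θ), sq_nonneg (w θ - y θ)]
  let Ψ : ℝ → ℝ := fun θ => phase c δ w y θ + C₁ * cylEnergy c (w θ) (y θ)
    + C₂ * (w θ * y θ) + -(1 / 20) * -log θ
  have hΨc : ContinuousOn Ψ (Icc δ (π / 3)) := by
    have h1 := (h.continuousOn_phase hδ (by linarith) hc hw).mono hsub
    have h2 := h.continuousOn_fst.mono hsub
    have h3 := h.continuousOn_snd.mono hsub
    have h4 : ContinuousOn (fun θ => cylEnergy c (w θ) (y θ)) (Icc δ (π / 3)) :=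
      fun θ hθ => (h.hasDerivAt_cylEnergy (hsub hθ)).continuousAt.continuousWithinAt
    have h5 : ContinuousOn log (Icc δ (π / 3)) :=
      continuousOn_log.mono fun θ hθ => (hδ.trans_le hθ.1).ne'
    fun_prop
  have hanti : AntitoneOn Ψ (Icc δ (π / 3)) := by
    have hder : ∀ θ ∈ Ioo δ (π / 3), ∃ d, HasDerivAt Ψ d θ ∧ d ≤ 0 := by
      intro θ hθ
      have hθ' : θ ∈ Icc δ (π / 2) := hsub (Ioo_subset_Icc_self hθ)
      have hθ0 : 0 < θ := hδ.trans hθ.1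
      have hs := sin_pos_of_mem_Icc hδ hθ'
      have hr := h.sq_add_sq_pos hδ hc hw hθ'
      have hcos : 1 / 2 ≤ cos θ := by
        rw [← cos_pi_div_three]
        exact cos_le_cos_of_nonneg_of_le_pi hθ0.le (by linarith) hθ.2.le
      have h1 := h.hasDerivAt_phase hδ hc hw ⟨hθ.1, by linarith [hθ.2]⟩
      have h2 := h.hasDerivAt_cylEnergy hθ'
      have h3 := (h.hasDerivAt_fst θ hθ').mul (h.hasDerivAt_snd θ hθ')
      have h4 := (hasDerivAt_log hθ0.ne').neg
      refine ⟨_, ((h1.add (h2.const_mul C₁)).add (h3.const_mul C₂)).add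
        (h4.const_mul (-(1 / 20))), ?_⟩
      have hrate := angularRate_le_of_sq hc hc' (w θ) (y θ) hs (by linarith) hr
      have hsθ : θ⁻¹ ≤ (sin θ)⁻¹ := inv_anti₀ hs (sin_lt hθ0).le
      have hg := mul_exp_sub_one_ge (abs_le.1 (hbd θ hθ').1).1 hM
      have hkC : C₂ * exp (-(E₀ + 1)) = 10 := by
        rw [hC₂, mul_assoc, ← exp_add]; simp
      have hkey : (-(1 / 20) + 10 * c * w θ ^ 2) + C₁ * -(c * cos θ * y θ ^ 2)
          + C₂ * (y θ * y θ + w θ * (-c * cos θ * y θ - 2 * c * (exp (w θ) - 1))) ≤ -(1 / 20) := by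
        set W := w θ
        set Y := y θ
        set τ := cos θ
        have hτ : τ ≤ 1 := cos_le_one θ
        have e1 : 20 * c * W ^ 2 ≤ 2 * c * C₂ * (W * (exp W - 1)) := by
          have := mul_le_mul_of_nonneg_left hg (by positivity : 0 ≤ 2 * c * C₂)
          calc _ = 2 * c * (C₂ * exp (-(E₀ + 1))) * W ^ 2 := by rw [hkC]; ring
            _ = 2 * c * C₂ * (exp (-(E₀ + 1)) * W ^ 2) := by ring
            _ ≤ _ := this
        have e2 : -(C₂ * τ * W * Y) ≤ 10 * W ^ 2 + C₂ ^ 2 / 40 * Y ^ 2 := by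
          have hsq : 0 ≤ 10 * (W + C₂ * τ * Y / 20) ^ 2 := by positivity
          have hτ2 : τ ^ 2 ≤ 1 := by nlinarith
          have : (C₂ * Y) ^ 2 * τ ^ 2 ≤ (C₂ * Y) ^ 2 * 1 :=
            mul_le_mul_of_nonneg_left hτ2 (sq_nonneg _)
          nlinarith
        have e2' := mul_le_mul_of_nonneg_left e2 (by linarith : 0 ≤ c)
        have e3 : C₁ * c * (1 / 2) * Y ^ 2 ≤ C₁ * c * τ * Y ^ 2 := by
          have : 0 ≤ C₁ * c := by positivity
          gcongr
        have e4 : C₂ * Y ^ 2 ≤ c * (C₂ * Y ^ 2) :=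
          le_mul_of_one_le_left (by positivity) hc
        have e5 : C₁ * c * (1 / 2) * Y ^ 2 = c * (C₂ * Y ^ 2) + c * (C₂ ^ 2 / 40 * Y ^ 2) := by
          rw [hC₁]; ring
        linarith
      have hkey' := mul_le_mul_of_nonneg_right hkey (inv_pos.2 hs).le
      have hrate' := hrate
      rw [div_eq_mul_inv] at hrate'
      simp only [div_eq_mul_inv] at hkey' ⊢
      simp only [one_mul] at hkey' ⊢
      nlinarith
    refine antitoneOn_of_deriv_nonpos (convex_Icc _ _) hΨc ?_ ?_
    · rw [interior_Icc]
      intro θ hθ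
      obtain ⟨d, hd, -⟩ := hder θ hθ
      exact hd.differentiableAt.differentiableWithinAt
    · rw [interior_Icc]
      intro θ hθ
      obtain ⟨d, hd, hd'⟩ := hder θ hθ
      rwa [hd.deriv]
  have hle := hanti ⟨le_rfl, hδ'⟩ ⟨hδ', le_rfl⟩ hδ'
  have hp0 : phase c δ w y δ ≤ π / 2 := by
    simpa [phase] using (arctan_lt_pi_div_two (y δ / w δ)).le
  have hm3 : π / 3 ∈ Icc δ (π / 2) := hsub ⟨hδ', le_rfl⟩
  have hlog : 0 ≤ log (π / 3) := log_nonneg (by linarith [pi_gt_three])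
  have hEn : 0 ≤ cylEnergy c (w (π / 3)) (y (π / 3)) := by
    have := add_one_le_exp (w (π / 3))
    have : 0 ≤ 2 * c * (exp (w (π / 3)) - 1 - w (π / 3)) := mul_nonneg (by linarith) (by linarith)
    rw [cylEnergy]
    nlinarith [sq_nonneg (y (π / 3))]
  have a1 := mul_le_mul_of_nonneg_left hE hC₁0.le
  have a2 := mul_nonneg hC₁0.le hEn
  have a3 := mul_le_mul_of_nonneg_left (abs_le.1 (hprod δ hδm)).2 hC₂0.le
  have a4 := mul_le_mul_of_nonneg_left (abs_le.1 (hprod _ hm3)).1 hC₂0.le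
  simp only [Ψ] at hle
  linarith

lemma phase_pi_div_two_le (h : IsCylSol c δ w y) (hδ : 0 < δ) (hδ' : δ ≤ π / 3) (hc : 1 ≤ c)
    (hw : w δ ≠ 0) : phase c δ w y (π / 2) ≤ phase c δ w y (π / 3) + c * π := by
  have hpi := pi_pos
  have hsub : Icc (π / 3) (π / 2) ⊆ Icc δ (π / 2) := Icc_subset_Icc_left hδ'
  have hder : ∀ θ ∈ Ioo (π / 3) (π / 2), HasDerivAt
      (fun θ => phase c δ w y θ - 2 * c * θ) (angularRate c (w θ) (y θ) θ - 2 * c * 1) θ :=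
    fun θ hθ => (h.hasDerivAt_phase hδ hc hw ⟨hδ'.trans_lt hθ.1, hθ.2⟩).sub
      ((hasDerivAt_id θ).const_mul (2 * c))
  have hanti : AntitoneOn (fun θ => phase c δ w y θ - 2 * c * θ) (Icc (π / 3) (π / 2)) := by
    refine antitoneOn_of_deriv_nonpos (convex_Icc _ _) ?_ ?_ ?_
    · have := (h.continuousOn_phase hδ (by linarith) hc hw).mono hsub
      fun_prop
    · rw [interior_Icc]
      exact fun θ hθ => (hder θ hθ).differentiableAt.differentiableWithinAt
    · rw [interior_Icc]
      intro θ hθ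
      rw [(hder θ hθ).deriv]
      have hθ' := hsub (Ioo_subset_Icc_self hθ)
      have hs := sin_pos_of_mem_Icc hδ hθ'
      have hrate := angularRate_le (c := c) (by linarith) (w θ) (y θ) hs
        (cos_nonneg_of_mem_Icc_of_pos hδ hθ') (h.sq_add_sq_pos hδ hc hw hθ')
      have hs2 : 1 / 2 ≤ sin θ := by
        rw [← sin_pi_div_six]
        exact sin_le_sin_of_le_of_le_pi_div_two (by linarith) hθ.2.le (by linarith [hθ.1])
      have : c / sin θ ≤ 2 * c := by
        rw [div_le_iff₀ hs]
        nlinarith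
      linarith
  have := hanti ⟨le_rfl, by linarith⟩ ⟨by linarith, le_rfl⟩ (by linarith)
  simp only at this
  nlinarith [mul_nonneg (by linarith : 0 ≤ c) hpi.le]

end IsCylSol

/-- The deviation `v - v⋆` of `v = log a + U` from the explicit singular solution
`v⋆ = -2 log sin θ + log ((m-1)/m)`. -/
noncomputable def deviation (m : ℕ) (U : ℝ → ℝ → ℝ) (a θ : ℝ) : ℝ :=
  log (a * m / (m - 1)) + U a θ + 2 * log (sin θ)

/-- The derivative of `deviation` with respect to `log tan (θ/2)`. -/
noncomputable def deviationVel (P : ℝ → ℝ → ℝ) (a θ : ℝ) : ℝ := sin θ * P a θ + 2 * cos θ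

/-- The starting angle from which the rotation of the deviation is measured. -/
noncomputable def startAngle (a : ℝ) : ℝ := (2 * √a)⁻¹

lemma continuousOn_integral_of_continuousOn {F : ℝ × ℝ → ℝ} {s : ℝ → ℝ} {A B b : ℝ}
    (hAB : A ≤ B) (hs : ContinuousOn s (Icc A B)) (hsb : ∀ a ∈ Icc A B, s a ≤ b)
    (hF : ContinuousOn F {x | x.1 ∈ Icc A B ∧ x.2 ∈ Icc (s x.1) b}) :
    ContinuousOn (fun a => ∫ θ in (s a)..b, F (a, θ)) (Icc A B) := by
  let ca : ℝ → ℝ := fun a => projIcc A B hAB a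
  have hca : Continuous ca := continuous_subtype_val.comp continuous_projIcc
  have hcam : ∀ a, ca a ∈ Icc A B := fun a => (projIcc A B hAB a).2
  have hsca : Continuous fun a => s (ca a) := hs.comp_continuous hca hcam
  let cl : ℝ × ℝ → ℝ × ℝ := fun x => (ca x.1, max (s (ca x.1)) (min x.2 b))
  have hcl : Continuous cl := by
    have h1 : Continuous fun x : ℝ × ℝ => s (ca x.1) := hsca.comp continuous_fst
    have h2 : Continuous fun x : ℝ × ℝ => ca x.1 := hca.comp continuous_fst
    exact h2.prodMk (h1.max (continuous_snd.min continuous_const))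
  have hf := hF.comp_continuous hcl fun x =>
    ⟨hcam x.1, le_max_left _ _, max_le (hsb _ (hcam x.1)) (min_le_right _ _)⟩
  have hintegral := intervalIntegral.continuous_parametric_intervalIntegral_of_continuous
    (μ := MeasureTheory.volume) (a₀ := b) (f := fun a θ => F (cl (a, θ))) hf hsca
  refine hintegral.neg.continuousOn.congr fun a ha => ?_
  have hcaa : ca a = a := by simp only [ca, projIcc_of_mem hAB ha]
  have hle := hsb a ha
  change ∫ θ in (s a)..b, F (a, θ) = -∫ θ in b..s (ca a), F (cl (a, θ))
  rw [intervalIntegral.integral_symm, hcaa]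
  congr 1
  refine intervalIntegral.integral_congr fun θ hθ => ?_
  rw [uIcc_of_ge hle] at hθ
  simp only [cl, hcaa, min_eq_left hθ.2, max_eq_right hθ.1]

lemma continuousOn_phase_of_continuousOn {c A B b : ℝ} {s : ℝ → ℝ} {w y : ℝ → ℝ → ℝ}
    (hAB : A ≤ B) (hs : ContinuousOn s (Icc A B)) (hsb : ∀ a ∈ Icc A B, s a ≤ b)
    (hw : ContinuousOn (fun x : ℝ × ℝ => w x.1 x.2) {x | x.1 ∈ Icc A B ∧ x.2 ∈ Icc (s x.1) b})
    (hy : ContinuousOn (fun x : ℝ × ℝ => y x.1 x.2) {x | x.1 ∈ Icc A B ∧ x.2 ∈ Icc (s x.1) b})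
    (hsin : ∀ a ∈ Icc A B, ∀ θ ∈ Icc (s a) b, 0 < sin θ)
    (hpos : ∀ a ∈ Icc A B, ∀ θ ∈ Icc (s a) b, 0 < w a θ ^ 2 + y a θ ^ 2)
    (hws : ∀ a ∈ Icc A B, w a (s a) ≠ 0) :
    ContinuousOn (fun a => phase c (s a) (w a) (y a) b) (Icc A B) := by
  have hrate : ContinuousOn (fun x : ℝ × ℝ => angularRate c (w x.1 x.2) (y x.1 x.2) x.2)
      {x | x.1 ∈ Icc A B ∧ x.2 ∈ Icc (s x.1) b} := by
    unfold angularRate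
    refine ContinuousOn.div (by fun_prop) (by fun_prop) fun x hx => ?_
    exact (mul_pos (hsin _ hx.1 _ hx.2) (hpos _ hx.1 _ hx.2)).ne'
  have hstart : ContinuousOn (fun a => ((a, s a) : ℝ × ℝ)) (Icc A B) := continuousOn_id.prodMk hs
  have hstartm : MapsTo (fun a => ((a, s a) : ℝ × ℝ)) (Icc A B)
      {x | x.1 ∈ Icc A B ∧ x.2 ∈ Icc (s x.1) b} := fun a ha => ⟨ha, le_rfl, hsb a ha⟩
  have hw' : ContinuousOn (fun a => w a (s a)) (Icc A B) := hw.comp hstart hstartm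
  have hy' : ContinuousOn (fun a => y a (s a)) (Icc A B) := hy.comp hstart hstartm
  exact (continuous_arctan.comp_continuousOn (hy'.div hw' hws)).add
    (continuousOn_integral_of_continuousOn hAB hs hsb hrate)

lemma startAngle_pos {a : ℝ} (ha : 2 ≤ a) : 0 < startAngle a := by
  have : 0 < √a := sqrt_pos.2 (by linarith)
  rw [startAngle]; positivity

lemma mul_startAngle_sq {a : ℝ} (ha : 2 ≤ a) : a * startAngle a ^ 2 = 1 / 4 := by
  have : a ≠ 0 := by positivity
  rw [startAngle, inv_pow, mul_pow, sq_sqrt (by linarith)]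
  field_simp
  norm_num

lemma startAngle_le {a : ℝ} (ha : 2 ≤ a) : startAngle a ≤ π / 3 := by
  have h1 := mul_startAngle_sq ha
  have h2 := startAngle_pos ha
  nlinarith [pi_gt_three]

lemma startAngle_mem_Icc {a : ℝ} (ha : 2 ≤ a) : startAngle a ∈ Icc 0 (π / 2) :=
  ⟨(startAngle_pos ha).le, (startAngle_le ha).trans (by linarith [pi_pos])⟩

section

variable {m : ℕ} {U P : ℝ → ℝ → ℝ}

lemma exp_deviation (hm : 2 ≤ m) {a : ℝ} (ha : 2 ≤ a) {θ : ℝ} (hs : 0 < sin θ) :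
    ((m:ℝ) - 1) * exp (deviation m U a θ) = a * m * exp (U a θ) * sin θ ^ 2 := by
  have hm' : (2:ℝ) ≤ m := by exact_mod_cast hm
  have hc : (0:ℝ) < m - 1 := by linarith
  have h2 : exp (2 * log (sin θ)) = sin θ ^ 2 := by
    rw [two_mul, exp_add, exp_log hs, sq]
  rw [deviation, exp_add, exp_add, exp_log (by positivity), h2]
  field_simp

lemma IsRegSol.isCylSol (hm : 2 ≤ m) {a : ℝ} (ha : 2 ≤ a) (h : IsRegSol m a (U a) (P a)) :
    IsCylSol (m - 1) (startAngle a) (deviation m U a) (deviationVel P a) := by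
  have hmem : ∀ θ ∈ Icc (startAngle a) (π / 2), θ ∈ Ioc 0 (π / 2) := fun θ hθ =>
    ⟨(startAngle_pos ha).trans_le hθ.1, hθ.2⟩
  refine ⟨fun θ hθ => ?_, fun θ hθ => ?_⟩
  · have hs := sin_pos_of_mem_Icc (startAngle_pos ha) hθ
    refine (((h.hasDerivAt_fst θ (hmem θ hθ)).const_add _).add
      (((hasDerivAt_sin θ).log hs.ne').const_mul 2)).congr_deriv ?_
    rw [deviationVel]
    field_simp
  · have hs := sin_pos_of_mem_Icc (startAngle_pos ha) hθ
    refine (((hasDerivAt_sin θ).mul (h.hasDerivAt_snd θ (hmem θ hθ))).add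
      ((hasDerivAt_cos θ).const_mul 2)).congr_deriv ?_
    have h1 := exp_deviation (U := U) hm ha hs
    have h2 := sin_sq_add_cos_sq θ
    rw [deviationVel]
    field_simp
    linear_combination (2:ℝ) * h1 + 2 * ((m:ℝ) - 1) * h2

lemma IsRegSol.deviation_startAngle (hm : 2 ≤ m) {a : ℝ} (ha : 2 ≤ a)
    (h : IsRegSol m a (U a) (P a)) :
    deviation m U a (startAngle a) < 0 ∧
      -(log 16 + m / 2) ≤ deviation m U a (startAngle a) := by
  have hm' : (2:ℝ) ≤ m := by exact_mod_cast hm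
  have hc : (0:ℝ) < m - 1 := by linarith
  have hδ := startAngle_pos ha
  have hδ2 := mul_startAngle_sq ha
  have hmem := startAngle_mem_Icc ha
  have hs := sin_pos_of_mem_Icc hδ ⟨le_rfl, hmem.2⟩
  have hs1 := sin_le hδ.le
  have hs2 : startAngle a / 2 ≤ sin (startAngle a) := by
    refine le_trans ?_ (mul_le_sin hδ.le hmem.2)
    have : 1 / 2 ≤ 2 / π := by
      rw [div_le_div_iff₀ two_pos pi_pos]
      linarith [pi_le_four]
    nlinarith
  have hu1 : a * sin (startAngle a) ^ 2 ≤ 1 / 4 := by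
    rw [← hδ2]; gcongr
  have hl1 : 1 / 16 ≤ a * sin (startAngle a) ^ 2 := by
    have : a * (startAngle a / 2) ^ 2 ≤ a * sin (startAngle a) ^ 2 := by gcongr
    nlinarith
  have hU := h.abs_fst_le _ hmem
  have hU0 := h.nonpos _ hmem
  have heq : deviation m U a (startAngle a)
      = log (m / (m - 1) * (a * sin (startAngle a) ^ 2)) + U a (startAngle a) := by
    have : m / (m - 1) * (a * sin (startAngle a) ^ 2)
        = (a * m / (m - 1)) * sin (startAngle a) ^ 2 := by ring
    rw [this, log_mul (by positivity) (by positivity), log_pow, deviation]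
    push_cast
    ring
  have hq1 : (1:ℝ) ≤ m / (m - 1) := by rw [le_div_iff₀ hc]; linarith
  have hq2 : (m:ℝ) / (m - 1) ≤ 2 := by rw [div_le_iff₀ hc]; linarith
  rw [heq]
  constructor
  · have : log (m / (m - 1) * (a * sin (startAngle a) ^ 2)) < 0 := by
      refine log_neg (by positivity) ?_
      nlinarith
    linarith
  · have h1 : -log 16 ≤ log (m / (m - 1) * (a * sin (startAngle a) ^ 2)) := by
      rw [← log_inv]
      refine log_le_log (by norm_num) ?_
      nlinarith
    have h2 := (abs_le.1 hU).1
    have h3 : 2 * m * a * startAngle a ^ 2 = m / 2 := by linear_combination 2 * (m:ℝ) * hδ2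
    linarith

/-- A bound, independent of `a`, for the energy of the deviation at the starting angle. -/
noncomputable def startEnergy (m : ℕ) : ℝ :=
  ((m:ℝ) / 2 + 2) ^ 2 / 2 + 2 * (m - 1) * (log 16 + m / 2)

lemma IsRegSol.cylEnergy_startAngle_le (hm : 2 ≤ m) {a : ℝ} (ha : 2 ≤ a)
    (h : IsRegSol m a (U a) (P a)) :
    cylEnergy (m - 1) (deviation m U a (startAngle a)) (deviationVel P a (startAngle a))
      ≤ startEnergy m := by
  have hm' : (2:ℝ) ≤ m := by exact_mod_cast hm
  have hc : (0:ℝ) < m - 1 := by linarith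
  have hδ := startAngle_pos ha
  have hmem := startAngle_mem_Icc ha
  have hδ2 := mul_startAngle_sq ha
  obtain ⟨h1, h2⟩ := h.deviation_startAngle hm ha
  have h3 : exp (deviation m U a (startAngle a)) ≤ 1 := exp_le_one_iff.2 h1.le
  have h4 : |deviationVel P a (startAngle a)| ≤ m / 2 + 2 := by
    have e1 := h.abs_snd_le _ hmem
    have e2 : |sin (startAngle a)| ≤ startAngle a := by
      rw [abs_of_nonneg (sin_pos_of_mem_Icc hδ ⟨le_rfl, hmem.2⟩).le]
      exact sin_le hδ.le
    calc _ ≤ |sin (startAngle a)| * |P a (startAngle a)| + 2 * |cos (startAngle a)| := by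
          rw [deviationVel]
          refine (abs_add_le _ _).trans ?_
          rw [abs_mul, abs_mul, abs_two]
      _ ≤ startAngle a * (2 * m * a * startAngle a) + 2 * 1 := by
          gcongr
          exact abs_cos_le_one _
      _ = _ := by linear_combination 2 * (m:ℝ) * hδ2
  have h5 : deviationVel P a (startAngle a) ^ 2 ≤ ((m:ℝ) / 2 + 2) ^ 2 :=
    sq_le_sq' (abs_le.1 h4).1 (abs_le.1 h4).2
  rw [cylEnergy, startEnergy]
  have h6 : 2 * ((m:ℝ) - 1) * (exp (deviation m U a (startAngle a)) - 1
      - deviation m U a (startAngle a)) ≤ 2 * (m - 1) * (log 16 + m / 2) :=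
    mul_le_mul_of_nonneg_left (by linarith) (by linarith)
  linarith

/-- The angle of the deviation at the equator. -/
noncomputable def equatorPhase (m : ℕ) (U P : ℝ → ℝ → ℝ) (a : ℝ) : ℝ :=
  phase (m - 1) (startAngle a) (deviation m U a) (deviationVel P a) (π / 2)

lemma exists_equatorPhase_le (hm : 2 ≤ m) (hm8 : m ≤ 8)
    (h : ∀ a, 2 ≤ a → IsRegSol m a (U a) (P a)) :
    ∃ C, ∀ a, 2 ≤ a → equatorPhase m U P a ≤ C - 1 / 20 * log (2 * √a) := by
  have hm' : (2:ℝ) ≤ m := by exact_mod_cast hm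
  have hm8' : (m:ℝ) ≤ 8 := by exact_mod_cast hm8
  set E₀ := startEnergy m with hE₀
  set C₂ := 10 * exp (E₀ + 1) with hC₂
  set C₁ := 2 * C₂ + C₂ ^ 2 / 20 with hC₁
  refine ⟨π / 2 + C₁ * E₀ + C₂ * ((E₀ + 1) ^ 2 + 2 * E₀) + (m - 1) * π, fun a ha => ?_⟩
  have hδ := startAngle_pos ha
  have hcyl := (h a ha).isCylSol hm ha
  have h1 := hcyl.phase_pi_div_three_le hδ (startAngle_le ha) (by linarith) (by linarith)
    ((h a ha).deviation_startAngle hm ha).1.ne ((h a ha).cylEnergy_startAngle_le hm ha) hC₂ hC₁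
  have h2 := hcyl.phase_pi_div_two_le hδ (startAngle_le ha) (by linarith)
    ((h a ha).deviation_startAngle hm ha).1.ne
  have h3 : log (startAngle a) = -log (2 * √a) := by rw [startAngle, log_inv]
  rw [h3] at h1
  rw [equatorPhase]
  linarith

lemma snd_eq_zero_of_equatorPhase (hm : 2 ≤ m) {a : ℝ} (ha : 2 ≤ a)
    (h : IsRegSol m a (U a) (P a)) (k : ℤ) (hk : equatorPhase m U P a = k * π) :
    P a (π / 2) = 0 := by
  have hm' : (2:ℝ) ≤ m := by exact_mod_cast hm
  have h1 := (h.isCylSol hm ha).mul_sin_phase_eq (startAngle_pos ha) (by linarith)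
    (h.deviation_startAngle hm ha).1.ne (θ := π / 2) ⟨(startAngle_mem_Icc ha).2, le_rfl⟩
  rw [equatorPhase] at hk
  rw [hk, sin_int_mul_pi, mul_zero, eq_comm, mul_eq_zero] at h1
  have h2 : cos (k * π) ≠ 0 := by
    intro h0
    have := sin_sq_add_cos_sq (k * π)
    rw [h0, sin_int_mul_pi] at this
    norm_num at this
  simpa [deviationVel] using h1.resolve_right h2

lemma continuousOn_equatorPhase (hm : 2 ≤ m) (h : ∀ a, 2 ≤ a → IsRegSol m a (U a) (P a))
    {B : ℝ} (hB : 2 ≤ B)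
    (hU : ContinuousOn (fun x : ℝ × ℝ => U x.1 x.2) (Icc 2 B ×ˢ Icc 0 (π / 2)))
    (hP : ContinuousOn (fun x : ℝ × ℝ => P x.1 x.2) (Icc 2 B ×ˢ Icc 0 (π / 2))) :
    ContinuousOn (equatorPhase m U P) (Icc 2 B) := by
  have hm' : (2:ℝ) ≤ m := by exact_mod_cast hm
  have hδc : ContinuousOn startAngle (Icc 2 B) := by
    unfold startAngle
    refine ContinuousOn.inv₀ (by fun_prop) fun a ha => ?_
    have : 0 < √a := sqrt_pos.2 (by linarith [ha.1])
    positivity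
  set S : Set (ℝ × ℝ) := {x | x.1 ∈ Icc 2 B ∧ x.2 ∈ Icc (startAngle x.1) (π / 2)} with hS
  have hSsub : S ⊆ Icc 2 B ×ˢ Icc 0 (π / 2) := fun x hx =>
    ⟨hx.1, (startAngle_pos hx.1.1).le.trans hx.2.1, hx.2.2⟩
  have hsin : ∀ x ∈ S, 0 < sin x.2 := fun x hx =>
    sin_pos_of_mem_Icc (startAngle_pos hx.1.1) hx.2
  have hw : ContinuousOn (fun x : ℝ × ℝ => deviation m U x.1 x.2) S := by
    have h1 := hU.mono hSsub
    have h2 : ContinuousOn (fun x : ℝ × ℝ => log (x.1 * m / (m - 1))) S := by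
      refine ContinuousOn.log (by fun_prop) fun x hx => ?_
      have : 0 < x.1 := by linarith [hx.1.1]
      have : (0:ℝ) < m - 1 := by linarith
      positivity
    have h3 : ContinuousOn (fun x : ℝ × ℝ => log (sin x.2)) S :=
      ContinuousOn.log (by fun_prop) fun x hx => (hsin x hx).ne'
    unfold deviation
    fun_prop
  have hy : ContinuousOn (fun x : ℝ × ℝ => deviationVel P x.1 x.2) S := by
    have h1 := hP.mono hSsub
    unfold deviationVel
    fun_prop
  exact continuousOn_phase_of_continuousOn hB hδc (fun a ha => (startAngle_mem_Icc ha.1).2) hw hy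
    (fun a ha _ => sin_pos_of_mem_Icc (startAngle_pos ha.1))
    (fun a ha _ => ((h a ha.1).isCylSol hm ha.1).sq_add_sq_pos (startAngle_pos ha.1)
      (by linarith) ((h a ha.1).deviation_startAngle hm ha.1).1.ne)
    fun a ha => ((h a ha.1).deviation_startAngle hm ha.1).1.ne

theorem exists_injective_snd_eq_zero (hm : 2 ≤ m) (hm8 : m ≤ 8)
    (h : ∀ a, 2 ≤ a → IsRegSol m a (U a) (P a))
    (hc : ∀ B, ContinuousOn (fun x : ℝ × ℝ => U x.1 x.2) (Icc 2 B ×ˢ Icc 0 (π / 2)) ∧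
      ContinuousOn (fun x : ℝ × ℝ => P x.1 x.2) (Icc 2 B ×ˢ Icc 0 (π / 2))) :
    ∃ a : ℕ → ℝ, Function.Injective a ∧ ∀ k, 2 ≤ a k ∧ P (a k) (π / 2) = 0 := by
  obtain ⟨C, hC⟩ := exists_equatorPhase_le hm hm8 h
  obtain ⟨k₀, hk₀⟩ := exists_nat_ge (-equatorPhase m U P 2 / π)
  have hex : ∀ k : ℕ, ∃ a, 2 ≤ a ∧ equatorPhase m U P a = (-(k + k₀ : ℤ) : ℤ) * π := by
    intro k
    set T : ℝ := (-(k + k₀ : ℤ) : ℤ) * π with hT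
    have hT2 : T ≤ equatorPhase m U P 2 := by
      rw [div_le_iff₀ pi_pos] at hk₀
      rw [hT]
      push_cast
      nlinarith [mul_nonneg (Nat.cast_nonneg (α := ℝ) k) pi_pos.le]
    set x : ℝ := max 1 (20 * (C - T))
    have hB : 2 ≤ exp (2 * x) := by
      have := add_one_le_exp (2 * x)
      linarith [le_max_left 1 (20 * (C - T))]
    have hsq : √(exp (2 * x)) = exp x := by
      rw [two_mul, exp_add, sqrt_mul_self (exp_pos x).le]
    have hTB : equatorPhase m U P (exp (2 * x)) ≤ T := by
      have h1 := hC _ hB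
      rw [hsq, log_mul two_ne_zero (exp_pos x).ne', log_exp] at h1
      have h2 : 0 ≤ log 2 := log_nonneg one_le_two
      linarith [le_max_right 1 (20 * (C - T))]
    obtain ⟨a, ha, ha'⟩ := intermediate_value_Icc' hB
      (continuousOn_equatorPhase hm h hB (hc _).1 (hc _).2) ⟨hTB, hT2⟩
    exact ⟨a, ha.1, ha'⟩
  choose a ha ha' using hex
  refine ⟨a, fun i j hij => ?_, fun k =>
    ⟨ha k, snd_eq_zero_of_equatorPhase hm (ha k) (h _ (ha k)) _ (ha' k)⟩⟩
  have h1 := ha' i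
  rw [hij, ha' j] at h1
  have h2 := mul_right_cancel₀ pi_pos.ne' h1
  have h3 : (-(j + k₀ : ℤ) : ℤ) = -(i + k₀ : ℤ) := by exact_mod_cast h2
  omega

end

lemma hasDerivWithinAt_of_reflection {f f' : ℝ → ℝ} {σ : ℝ} {s : Set ℝ} (hσ : σ * σ = 1)
    (hf : ∀ θ, f (π - θ) = σ * f θ) (hf' : ∀ θ, f' (π - θ) = -σ * f' θ)
    (hs : ∀ θ ∈ s, π - θ ∈ s)
    (h : ∀ θ ∈ s, θ ≤ π / 2 → HasDerivWithinAt f (f' θ) (s ∩ Iic (π / 2)) θ) :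
    ∀ θ ∈ s, HasDerivWithinAt f (f' θ) s θ := by
  have h' : ∀ θ ∈ s, π / 2 ≤ θ → HasDerivWithinAt f (f' θ) (s ∩ Ici (π / 2)) θ := by
    intro θ hθ hle
    have h1 := h (π - θ) (hs θ hθ) (by linarith)
    have h2 := (h1.comp θ ((hasDerivAt_id θ).const_sub π).hasDerivWithinAt
      (s := s ∩ Ici (π / 2)) fun t ht => ⟨hs t ht.1, by
        have := mem_Ici.1 ht.2
        simp only [mem_Iic]
        linarith⟩).const_mul σ
    refine (h2.congr_deriv ?_).congr_of_mem (fun t _ => ?_) ⟨hθ, hle⟩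
    · rw [hf']
      linear_combination f' θ * hσ
    · simp only [Function.comp, hf]
      linear_combination -f t * hσ
  intro θ hθ
  rcases lt_trichotomy θ (π / 2) with hlt | heq | hgt
  · exact (h θ hθ hlt.le).mono_of_mem_nhdsWithin
      (inter_mem_nhdsWithin s (Iic_mem_nhds hlt))
  · have := (h θ hθ heq.le).union (h' θ hθ heq.ge)
    rwa [← inter_union_distrib_left, Iic_union_Ici, inter_univ] at this
  · exact (h' θ hθ hgt.le).mono_of_mem_nhdsWithin
      (inter_mem_nhdsWithin s (Ici_mem_nhds hgt))

/-- The solution on the sphere obtained by reflecting `log a + u` across the equator. -/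
noncomputable def sphereSol (a : ℝ) (u : ℝ → ℝ) (θ : ℝ) : ℝ := log a + u (min θ (π - θ))

/-- The derivative of `sphereSol`. -/
noncomputable def sphereVel (p : ℝ → ℝ) (θ : ℝ) : ℝ :=
  p (min θ (π / 2)) - p (min (π - θ) (π / 2))

lemma sphereSol_reflect (a : ℝ) (u : ℝ → ℝ) (θ : ℝ) :
    sphereSol a u (π - θ) = sphereSol a u θ := by
  rw [sphereSol, sphereSol, sub_sub_cancel, min_comm]

lemma sphereVel_reflect (p : ℝ → ℝ) (θ : ℝ) : sphereVel p (π - θ) = -sphereVel p θ := by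
  rw [sphereVel, sphereVel, sub_sub_cancel, neg_sub]

lemma sphereSol_of_le (a : ℝ) (u : ℝ → ℝ) {θ : ℝ} (hθ : θ ≤ π / 2) :
    sphereSol a u θ = log a + u θ := by
  rw [sphereSol, min_eq_left (by linarith)]

lemma sphereVel_of_le {p : ℝ → ℝ} (hp : p (π / 2) = 0) {θ : ℝ} (hθ : θ ≤ π / 2) :
    sphereVel p θ = p θ := by
  rw [sphereVel, min_eq_left hθ, min_eq_right (by linarith), hp, sub_zero]

namespace IsRegSol

variable {m : ℕ} {a : ℝ} {u p : ℝ → ℝ}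

lemma hasDerivWithinAt_zero (h : IsRegSol m a u p) :
    HasDerivWithinAt u 0 (Icc 0 (π / 2)) 0 := by
  have h0 : (0:ℝ) ∈ Icc 0 (π / 2) := ⟨le_rfl, by positivity⟩
  have hO : u =O[nhdsWithin 0 (Icc 0 (π / 2))] fun θ => ‖θ - 0‖ ^ 2 := by
    refine Asymptotics.IsBigO.of_bound (2 * m * a) ?_
    filter_upwards [self_mem_nhdsWithin] with θ hθ
    simpa using h.abs_fst_le θ hθ
  have := hO.hasFDerivWithinAt (𝕜 := ℝ) h0 one_lt_two
  exact (hasFDerivWithinAt_iff_hasDerivWithinAt.1 this).congr_deriv (by simp)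

lemma hasDerivWithinAt_sphereSol (h : IsRegSol m a u p) (hp : p (π / 2) = 0) :
    ∀ θ ∈ Icc 0 π, HasDerivWithinAt (sphereSol a u) (sphereVel p θ) (Icc 0 π) θ := by
  refine hasDerivWithinAt_of_reflection (one_mul 1)
    (fun θ => by rw [sphereSol_reflect, one_mul])
    (fun θ => by rw [sphereVel_reflect, neg_one_mul])
    (fun θ hθ => ⟨by linarith [hθ.2], by linarith [hθ.1]⟩) fun θ hθ hle => ?_
  rw [sphereVel_of_le hp hle]
  have hsub : Icc 0 π ∩ Iic (π / 2) ⊆ Icc 0 (π / 2) := fun t ht => ⟨ht.1.1, ht.2⟩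
  refine HasDerivWithinAt.congr_of_mem (f := fun t => log a + u t) ?_
    (fun t ht => sphereSol_of_le a u ht.2) ⟨hθ, hle⟩
  refine HasDerivWithinAt.const_add _ (HasDerivWithinAt.mono ?_ hsub)
  rcases hθ.1.eq_or_lt with rfl | hpos
  · have hp0 : p 0 = 0 := by simpa using h.abs_snd_le 0 ⟨le_rfl, hle⟩
    rw [hp0]
    exact h.hasDerivWithinAt_zero
  · exact (h.hasDerivAt_fst θ ⟨hpos, hle⟩).hasDerivWithinAt

lemma hasDerivAt_sphereSol (h : IsRegSol m a u p) (hp : p (π / 2) = 0) {θ : ℝ}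
    (hθ : θ ∈ Ioo 0 π) : HasDerivAt (sphereSol a u) (sphereVel p θ) θ :=
  (h.hasDerivWithinAt_sphereSol hp θ (Ioo_subset_Icc_self hθ)).hasDerivAt
    (Icc_mem_nhds hθ.1 hθ.2)

lemma hasDerivAt_sphereVel (h : IsRegSol m a u p) (ha : 0 < a) (hp : p (π / 2) = 0) {θ : ℝ}
    (hθ : θ ∈ Ioo 0 π) : HasDerivAt (sphereVel p)
      (-m * (cos θ / sin θ) * sphereVel p θ - 2 * m * (exp (sphereSol a u θ) - 1)) θ := by
  refine (hasDerivWithinAt_of_reflection (σ := -1) (s := Ioo 0 π) (f' := fun θ =>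
    -m * (cos θ / sin θ) * sphereVel p θ - 2 * m * (exp (sphereSol a u θ) - 1)) (by norm_num)
    (fun θ => by rw [sphereVel_reflect, neg_one_mul])
    (fun θ => by
      rw [sphereVel_reflect, sphereSol_reflect, cos_pi_sub, sin_pi_sub]
      ring)
    (fun θ hθ => ⟨by linarith [hθ.2], by linarith [hθ.1]⟩) (fun θ hθ hle => ?_) θ hθ).hasDerivAt
    (Ioo_mem_nhds hθ.1 hθ.2)
  rw [sphereVel_of_le hp hle, sphereSol_of_le a u hle, exp_add, exp_log ha]
  exact (h.hasDerivAt_snd θ ⟨hθ.1, hle⟩).hasDerivWithinAt.congr_of_mem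
    (fun t ht => sphereVel_of_le hp ht.2) ⟨hθ, hle⟩

lemma continuousOn_sphereVel (h : IsRegSol m a u p) : ContinuousOn (sphereVel p) (Icc 0 π) := by
  have hpi := pi_pos
  refine (h.continuousOn_snd.comp (t := Icc 0 (π / 2)) (by fun_prop) fun θ hθ => ?_).sub
    (h.continuousOn_snd.comp (t := Icc 0 (π / 2)) (by fun_prop) fun θ hθ => ?_)
  · exact ⟨le_min hθ.1 (by linarith), min_le_right _ _⟩
  · exact ⟨le_min (by linarith [hθ.2]) (by linarith), min_le_right _ _⟩

lemma contDiffOn_one_sphereSol (h : IsRegSol m a u p) (hp : p (π / 2) = 0) :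
    ContDiffOn ℝ 1 (sphereSol a u) (Icc 0 π) := by
  rw [contDiffOn_one_iff_derivWithin (uniqueDiffOn_Icc pi_pos)]
  refine ⟨fun θ hθ => (h.hasDerivWithinAt_sphereSol hp θ hθ).differentiableWithinAt,
    h.continuousOn_sphereVel.congr fun θ hθ => ?_⟩
  exact (h.hasDerivWithinAt_sphereSol hp θ hθ).derivWithin (uniqueDiffOn_Icc pi_pos θ hθ)

lemma contDiffOn_two_sphereSol (h : IsRegSol m a u p) (ha : 0 < a) (hp : p (π / 2) = 0) :
    ContDiffOn ℝ 2 (sphereSol a u) (Ioo 0 π) := by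
  have hV : ∀ θ ∈ Ioo 0 π, HasDerivAt (sphereSol a u) (sphereVel p θ) θ :=
    fun θ => h.hasDerivAt_sphereSol hp
  have hD : ∀ θ ∈ Ioo 0 π, HasDerivAt (sphereVel p) _ θ := fun θ => h.hasDerivAt_sphereVel ha hp
  have hVc : ContinuousOn (sphereSol a u) (Ioo 0 π) :=
    fun θ hθ => (hV θ hθ).continuousAt.continuousWithinAt
  have hDc : ContinuousOn (sphereVel p) (Ioo 0 π) :=
    fun θ hθ => (hD θ hθ).continuousAt.continuousWithinAt
  have hcot : ContinuousOn (fun θ => cos θ / sin θ) (Ioo 0 π) :=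
    continuousOn_cos.div continuousOn_sin fun θ hθ => (sin_pos_of_mem_Ioo hθ).ne'
  rw [← one_add_one_eq_two, contDiffOn_succ_iff_deriv_of_isOpen isOpen_Ioo]
  refine ⟨fun θ hθ => (hV θ hθ).differentiableAt.differentiableWithinAt, by simp, ?_⟩
  refine ContDiffOn.congr ?_ fun θ hθ => (hV θ hθ).deriv
  rw [← zero_add (1 : WithTop ℕ∞), contDiffOn_succ_iff_deriv_of_isOpen isOpen_Ioo]
  refine ⟨fun θ hθ => (hD θ hθ).differentiableAt.differentiableWithinAt, by simp, ?_⟩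
  rw [contDiffOn_zero]
  refine ContinuousOn.congr ?_ fun θ hθ => (hD θ hθ).deriv
  fun_prop

lemma deriv_deriv_sphereSol (h : IsRegSol m a u p) (ha : 0 < a) (hp : p (π / 2) = 0) {θ : ℝ}
    (hθ : θ ∈ Ioo 0 π) :
    deriv (deriv (sphereSol a u)) θ + m * (cos θ / sin θ) * deriv (sphereSol a u) θ
      + 2 * m * (exp (sphereSol a u θ) - 1) = 0 := by
  have hev : deriv (sphereSol a u) =ᶠ[nhds θ] sphereVel p := by
    filter_upwards [Ioo_mem_nhds hθ.1 hθ.2] with t ht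
    exact (h.hasDerivAt_sphereSol hp ht).deriv
  rw [hev.deriv_eq, hev.eq_of_nhds, (h.hasDerivAt_sphereVel ha hp hθ).deriv]
  ring

lemma derivWithin_sphereSol_zero (h : IsRegSol m a u p) (hp : p (π / 2) = 0) :
    derivWithin (sphereSol a u) (Icc 0 π) 0 = 0 := by
  have h0 : (0:ℝ) ∈ Icc 0 π := ⟨le_rfl, pi_pos.le⟩
  have hp2 : (0:ℝ) ≤ π / 2 := by positivity
  rw [(h.hasDerivWithinAt_sphereSol hp 0 h0).derivWithin (uniqueDiffOn_Icc pi_pos 0 h0),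
    sphereVel_of_le hp hp2]
  simpa using h.abs_snd_le 0 ⟨le_rfl, hp2⟩

lemma derivWithin_sphereSol_pi (h : IsRegSol m a u p) (hp : p (π / 2) = 0) :
    derivWithin (sphereSol a u) (Icc 0 π) π = 0 := by
  have h1 : π ∈ Icc 0 π := ⟨pi_pos.le, le_rfl⟩
  have h0 : (0:ℝ) ∈ Icc 0 π := ⟨le_rfl, pi_pos.le⟩
  have h2 := h.derivWithin_sphereSol_zero hp
  rw [(h.hasDerivWithinAt_sphereSol hp 0 h0).derivWithin (uniqueDiffOn_Icc pi_pos 0 h0)] at h2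
  rw [(h.hasDerivWithinAt_sphereSol hp π h1).derivWithin (uniqueDiffOn_Icc pi_pos π h1),
    ← sub_zero π, sphereVel_reflect, h2, neg_zero]

lemma sphereSol_zero (h : IsRegSol m a u p) : sphereSol a u 0 = log a := by
  rw [sphereSol_of_le a u (by positivity), h.zero, add_zero]

lemma exists_sphereSol_ne (h : IsRegSol m a u p) (hm : m ≠ 0) (ha : 1 < a)
    (hp : p (π / 2) = 0) :
    ∃ θ₁ ∈ Icc 0 π, ∃ θ₂ ∈ Icc 0 π, sphereSol a u θ₁ ≠ sphereSol a u θ₂ := by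
  by_contra! hconst
  have h0 : (0:ℝ) ∈ Icc 0 π := ⟨le_rfl, pi_pos.le⟩
  have hmid : π / 2 ∈ Ioo 0 π := ⟨by positivity, by linarith [pi_pos]⟩
  have hvel : ∀ θ ∈ Ioo 0 π, sphereVel p θ = 0 := by
    intro θ hθ
    refine (h.hasDerivAt_sphereSol hp hθ).unique
      ((hasDerivAt_const θ (log a)).congr_of_eventuallyEq ?_)
    filter_upwards [Ioo_mem_nhds hθ.1 hθ.2] with t ht
    rw [← h.sphereSol_zero]
    exact hconst t (Ioo_subset_Icc_self ht) 0 h0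
  have hacc := (h.hasDerivAt_sphereVel (by linarith) hp hmid).unique
    ((hasDerivAt_const (π / 2) (0:ℝ)).congr_of_eventuallyEq (by
      filter_upwards [Ioo_mem_nhds hmid.1 hmid.2] with t ht using hvel t ht))
  rw [hvel _ hmid, hconst _ (Ioo_subset_Icc_self hmid) 0 h0, h.sphereSol_zero,
    exp_log (by linarith)] at hacc
  have hm' : (0:ℝ) < m := by positivity
  nlinarith

end IsRegSol

theorem stmt_0 (N : ℕ) (hN : 4 ≤ N) (hN' : N ≤ 10) :
    ∃ V : ℕ → ℝ → ℝ,
      (∀ i j : ℕ, i ≠ j → ∃ θ ∈ Icc (0:ℝ) π, V i θ ≠ V j θ) ∧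
      ∀ k : ℕ,
        (∃ θ₁ ∈ Icc (0:ℝ) π, ∃ θ₂ ∈ Icc (0:ℝ) π, V k θ₁ ≠ V k θ₂) ∧
        ContDiffOn ℝ 2 (V k) (Ioo 0 π) ∧
        ContDiffOn ℝ 1 (V k) (Icc 0 π) ∧
        (∀ θ ∈ Ioo (0:ℝ) π,
          deriv (deriv (V k)) θ + ((N : ℝ) - 2) * (Real.cos θ / Real.sin θ) * deriv (V k) θ
            + 2 * ((N : ℝ) - 2) * (Real.exp (V k θ) - 1) = 0) ∧
        derivWithin (V k) (Icc 0 π) 0 = 0 ∧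
        derivWithin (V k) (Icc 0 π) π = 0 ∧
        (∀ θ ∈ Icc (0:ℝ) π, V k θ = V k (π - θ)) := by
  obtain ⟨m, rfl⟩ : ∃ m, N = m + 2 := ⟨N - 2, by omega⟩
  have hm : m ≠ 0 := by omega
  have hcast : ((m + 2 : ℕ) : ℝ) - 2 = m := by push_cast; ring
  obtain ⟨U, P, hreg, hc⟩ := exists_isRegSol_family hm
  obtain ⟨a, hinj, ha⟩ := exists_injective_snd_eq_zero (by omega) (by omega) hreg hc
  have ha0 : ∀ k, 0 < a k := fun k => by linarith [(ha k).1]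
  have hsol : ∀ k, IsRegSol m (a k) (U (a k)) (P (a k)) := fun k => hreg _ (ha k).1
  refine ⟨fun k => sphereSol (a k) (U (a k)), fun i j hij => ⟨0, ⟨le_rfl, pi_pos.le⟩, ?_⟩,
    fun k => ⟨(hsol k).exists_sphereSol_ne hm (by linarith [(ha k).1]) (ha k).2,
      (hsol k).contDiffOn_two_sphereSol (ha0 k) (ha k).2,
      (hsol k).contDiffOn_one_sphereSol (ha k).2, fun θ hθ => ?_,
      (hsol k).derivWithin_sphereSol_zero (ha k).2,
      (hsol k).derivWithin_sphereSol_pi (ha k).2,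
      fun θ _ => (sphereSol_reflect _ _ θ).symm⟩⟩
  · simp only [(hsol i).sphereSol_zero, (hsol j).sphereSol_zero]
    exact fun h => hij (hinj (log_injOn_pos (ha0 i) (ha0 j) h))
  · rw [hcast]
    exact (hsol k).deriv_deriv_sphereSol (ha0 k) (ha k).2 hθ
end

section
/- Let N ≥ 4 be an integer, ᾱ ∈ ℝ, and κ̄ := log(2(N−3)). There exists exactly one function x̄ ∈ C²(ℝ) satisfying x̄''(s) + (N−3) x̄'(s) + 2(N−3)(e^{x̄(s)} − 1) = 0 for all s ∈ ℝ, x̄(s) − 2s + κ̄ − ᾱ → 0 as s → −∞, and e^{−s}(x̄'(s) − 2) → 0 as s → −∞. -/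
open Real Set Filter

/-- The antiderivative of `t ↦ exp (c * t) * h t` that vanishes at `-∞`. -/
noncomputable def expIntegral (c : ℝ) (h : ℝ → ℝ) (s : ℝ) : ℝ :=
  ∫ t in Iic s, exp (c * t) * h t

/-- The average of `h` over `(-∞, s]` with weight `exp (c * t)`, up to the factor `c`. -/
noncomputable def expMean (c : ℝ) (h : ℝ → ℝ) (s : ℝ) : ℝ :=
  exp (-(c * s)) * expIntegral c h s

/-- The solution `v` of `v'' + (c - 2) v' = exp (2 s) h` that vanishes at `-∞`. -/
noncomputable def expPotential (c : ℝ) (h : ℝ → ℝ) : ℝ → ℝ :=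
  expIntegral 2 (expMean c h)

lemma hasDerivAt_exp_mul (c s : ℝ) :
    HasDerivAt (fun t => exp (c * t)) (c * exp (c * s)) s := by
  have := ((hasDerivAt_id s).const_mul c).exp
  simpa [mul_comm] using this

lemma tendsto_exp_mul_atBot {c : ℝ} (hc : 0 < c) :
    Tendsto (fun t => exp (c * t)) atBot (nhds 0) :=
  tendsto_exp_atBot.comp (tendsto_id.const_mul_atBot hc)

lemma abs_le_of_abs_deriv_le {f f' g g' : ℝ → ℝ}
    (hf : ∀ s, HasDerivAt f (f' s) s) (hg : ∀ s, HasDerivAt g (g' s) s)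
    (hle : ∀ s, |f' s| ≤ g' s) (hf0 : Tendsto f atBot (nhds 0))
    (hg0 : Tendsto g atBot (nhds 0)) (s : ℝ) : |f s| ≤ g s := by
  have h1 : Monotone (g - f) := monotone_of_deriv_nonneg
    (fun s => ((hg s).sub (hf s)).differentiableAt) fun s => by
      rw [((hg s).sub (hf s)).deriv]
      linarith [le_abs_self (f' s), hle s]
  have h2 : Monotone (g + f) := monotone_of_deriv_nonneg
    (fun s => ((hg s).add (hf s)).differentiableAt) fun s => by
      rw [((hg s).add (hf s)).deriv]
      linarith [neg_abs_le (f' s), hle s]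
  have h3 : 0 ≤ (g - f) s := h1.le_of_tendsto (by simpa using! hg0.sub hf0) s
  have h4 : 0 ≤ (g + f) s := h2.le_of_tendsto (by simpa using! hg0.add hf0) s
  simp only [Pi.sub_apply, Pi.add_apply] at h3 h4
  exact abs_le.2 ⟨by linarith, by linarith⟩

lemma eq_of_hasDerivAt_of_tendsto {f g f' : ℝ → ℝ}
    (hf : ∀ s, HasDerivAt f (f' s) s) (hg : ∀ s, HasDerivAt g (f' s) s)
    (hf0 : Tendsto f atBot (nhds 0)) (hg0 : Tendsto g atBot (nhds 0)) : f = g := by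
  funext s
  have := abs_le_of_abs_deriv_le (f := f - g) (f' := fun _ => 0) (g := fun _ => 0)
    (g' := fun _ => 0) (fun s => by simpa using (hf s).sub (hg s))
    (fun s => hasDerivAt_const s 0) (by simp) (by simpa using! hf0.sub hg0)
    tendsto_const_nhds s
  simpa [sub_eq_zero] using this

section expIntegral

variable {c C : ℝ} {h : ℝ → ℝ}

lemma integrableOn_exp_mul_mul (hc : 0 < c) (hh : Continuous h) (hb : ∀ s, |h s| ≤ C) (s : ℝ) :
    MeasureTheory.IntegrableOn (fun t => exp (c * t) * h t) (Iic s) :=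
  MeasureTheory.Integrable.mul_bdd (c := C) (integrableOn_exp_mul_Iic hc s)
    hh.aestronglyMeasurable (Eventually.of_forall hb)

lemma hasDerivAt_expIntegral (hc : 0 < c) (hh : Continuous h) (hb : ∀ s, |h s| ≤ C) (s : ℝ) :
    HasDerivAt (expIntegral c h) (exp (c * s) * h s) s := by
  have hcont : Continuous fun t => exp (c * t) * h t := by fun_prop
  have heq : expIntegral c h = fun r =>
      expIntegral c h s + ∫ t in s..r, exp (c * t) * h t := by
    funext r
    rw [← intervalIntegral.integral_Iic_sub_Iic (integrableOn_exp_mul_mul hc hh hb s)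
      (integrableOn_exp_mul_mul hc hh hb r)]
    simp [expIntegral]
  rw [heq]
  exact (hcont.integral_hasStrictDerivAt s s).hasDerivAt.const_add _

lemma abs_expIntegral_le (hc : 0 < c) (hb : ∀ s, |h s| ≤ C) (s : ℝ) :
    |expIntegral c h s| ≤ C / c * exp (c * s) := by
  have hle : ‖expIntegral c h s‖ ≤ ∫ t in Iic s, exp (c * t) * C :=
    MeasureTheory.norm_integral_le_of_norm_le ((integrableOn_exp_mul_Iic hc s).mul_const C)
      (Eventually.of_forall fun t => by
        rw [norm_mul, norm_of_nonneg (exp_pos _).le]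
        exact mul_le_mul_of_nonneg_left (hb t) (exp_pos _).le)
  rw [MeasureTheory.integral_mul_const, integral_exp_mul_Iic hc] at hle
  calc |expIntegral c h s| ≤ exp (c * s) / c * C := hle
    _ = C / c * exp (c * s) := by ring

lemma tendsto_expIntegral (hc : 0 < c) (hb : ∀ s, |h s| ≤ C) :
    Tendsto (expIntegral c h) atBot (nhds 0) :=
  squeeze_zero_norm (abs_expIntegral_le hc hb)
    (by simpa using (tendsto_exp_mul_atBot hc).const_mul (C / c))

lemma expIntegral_eq_exp_mul_expMean (c : ℝ) (h : ℝ → ℝ) (s : ℝ) :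
    expIntegral c h s = exp (c * s) * expMean c h s := by
  rw [expMean, ← mul_assoc, ← exp_add]
  simp

lemma abs_expMean_le (hc : 0 < c) (hb : ∀ s, |h s| ≤ C) (s : ℝ) :
    |expMean c h s| ≤ C / c := by
  have := abs_expIntegral_le hc hb s
  rw [expIntegral_eq_exp_mul_expMean, abs_mul, abs_of_pos (exp_pos _), mul_comm] at this
  exact le_of_mul_le_mul_right this (exp_pos _)

lemma continuous_expMean (hc : 0 < c) (hh : Continuous h) (hb : ∀ s, |h s| ≤ C) :
    Continuous (expMean c h) := by
  have : Continuous (expIntegral c h) := continuous_iff_continuousAt.2 fun s =>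
    (hasDerivAt_expIntegral hc hh hb s).continuousAt
  unfold expMean
  fun_prop

lemma hasDerivAt_expMean (hc : 0 < c) (hh : Continuous h) (hb : ∀ s, |h s| ≤ C) (s : ℝ) :
    HasDerivAt (expMean c h) (h s - c * expMean c h s) s := by
  have h1 : HasDerivAt (fun t => exp (-(c * t))) (-c * exp (-(c * s))) s := by
    simpa using hasDerivAt_exp_mul (-c) s
  have h2 := h1.mul (hasDerivAt_expIntegral hc hh hb s)
  convert! h2 using 1
  rw [← mul_assoc (exp (-(c * s))), ← exp_add, expMean]
  simp
  ring

lemma hasDerivAt_expPotential (hc : 0 < c) (hh : Continuous h) (hb : ∀ s, |h s| ≤ C) (s : ℝ) :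
    HasDerivAt (expPotential c h) (exp (2 * s) * expMean c h s) s :=
  hasDerivAt_expIntegral two_pos (continuous_expMean hc hh hb) (abs_expMean_le hc hb) s

lemma abs_expPotential_le (hc : 0 < c) (hb : ∀ s, |h s| ≤ C) (s : ℝ) :
    |expPotential c h s| ≤ C / c / 2 * exp (2 * s) :=
  abs_expIntegral_le two_pos (abs_expMean_le hc hb) s

lemma tendsto_expPotential (hc : 0 < c) (hb : ∀ s, |h s| ≤ C) :
    Tendsto (expPotential c h) atBot (nhds 0) :=
  tendsto_expIntegral two_pos (abs_expMean_le hc hb)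

lemma hasDerivAt_exp_mul_exp (l s : ℝ) :
    HasDerivAt (fun t => exp (l * exp (2 * t)))
      (2 * l * exp (2 * s) * exp (l * exp (2 * s))) s := by
  convert! ((hasDerivAt_exp_mul 2 s).const_mul l).exp using 1
  ring

lemma tendsto_exp_mul_exp (l : ℝ) :
    Tendsto (fun t => exp (l * exp (2 * t))) atBot (nhds 1) := by
  have := (continuous_exp.tendsto (l * 0)).comp
    ((tendsto_exp_mul_atBot two_pos).const_mul l)
  simpa using! this

/-- In the norm with weight `exp (-l * exp (2 s))`, the potential of a difference is small for
large `l`. -/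
lemma abs_expPotential_sub_le {k : ℝ → ℝ} {D l : ℝ} (hc : 0 < c) (hl : 0 < l) (hD : 0 ≤ D)
    (hh : Continuous h) (hb : ∀ s, |h s| ≤ C) (hk : Continuous k) (hkb : ∀ s, |k s| ≤ C)
    (hd : ∀ s, |h s - k s| ≤ D * exp (l * exp (2 * s))) (s : ℝ) :
    |expPotential c h s - expPotential c k s| ≤ D / (2 * l * c) * exp (l * exp (2 * s)) := by
  have hmean : ∀ s, |expMean c h s - expMean c k s| ≤ D / c * exp (l * exp (2 * s)) := by
    intro s
    have key := abs_le_of_abs_deriv_le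
      (g := fun s => D / c * (exp (c * s) * exp (l * exp (2 * s))))
      (fun s => (hasDerivAt_expIntegral hc hh hb s).sub (hasDerivAt_expIntegral hc hk hkb s))
      (fun s => ((hasDerivAt_exp_mul c s).mul (hasDerivAt_exp_mul_exp l s)).const_mul (D / c))
      (fun s => ?_)
      (by simpa using! (tendsto_expIntegral hc hb).sub (tendsto_expIntegral hc hkb))
      (by simpa using! ((tendsto_exp_mul_atBot hc).mul (tendsto_exp_mul_exp l)).const_mul (D / c)) s
    · simp only [Pi.sub_apply] at key
      rw [expIntegral_eq_exp_mul_expMean, expIntegral_eq_exp_mul_expMean, ← mul_sub, abs_mul,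
        abs_of_pos (exp_pos _), mul_left_comm] at key
      exact le_of_mul_le_mul_left key (exp_pos _)
    · rw [← mul_sub, abs_mul, abs_of_pos (exp_pos _)]
      have h1 := mul_le_mul_of_nonneg_left (hd s) (exp_pos (c * s)).le
      have h2 : 0 ≤ D / c * (exp (c * s) * (2 * l * exp (2 * s) * exp (l * exp (2 * s)))) := by
        positivity
      have h3 : D / c * (c * exp (c * s) * exp (l * exp (2 * s)))
          = exp (c * s) * (D * exp (l * exp (2 * s))) := by
        field_simp
      linarith
  have key := abs_le_of_abs_deriv_le
    (g := fun s => D / (2 * l * c) * (exp (l * exp (2 * s)) - 1))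
    (fun s => (hasDerivAt_expPotential hc hh hb s).sub (hasDerivAt_expPotential hc hk hkb s))
    (fun s => ((hasDerivAt_exp_mul_exp l s).sub_const 1).const_mul (D / (2 * l * c)))
    (fun s => ?_)
    (by simpa using! (tendsto_expPotential hc hb).sub (tendsto_expPotential hc hkb))
    (by simpa using! ((tendsto_exp_mul_exp l).sub_const 1).const_mul (D / (2 * l * c))) s
  · have : 0 ≤ D / (2 * l * c) := by positivity
    simp only [Pi.sub_apply] at key
    linarith
  · rw [← mul_sub, abs_mul, abs_of_pos (exp_pos _)]
    refine (mul_le_mul_of_nonneg_left (hmean s) (exp_pos _).le).trans_eq ?_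
    field_simp

end expIntegral

/-- The exponential nonlinearity, truncated above `0`. -/
noncomputable def truncExp (z : ℝ) : ℝ := exp (min z 0)

lemma continuous_truncExp : Continuous truncExp := by
  unfold truncExp
  fun_prop

lemma abs_truncExp_le (z : ℝ) : |truncExp z| ≤ 1 := by
  rw [truncExp, abs_of_pos (exp_pos _)]
  exact exp_le_one_iff.2 (min_le_right _ _)

lemma abs_truncExp_sub_le (z w : ℝ) : |truncExp z - truncExp w| ≤ |z - w| := by
  wlog hzw : w ≤ z generalizing z w
  · rw [abs_sub_comm, abs_sub_comm z]
    exact this w z (le_of_not_ge hzw)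
  have h1 : min w 0 ≤ min z 0 := min_le_min_right 0 hzw
  have h2 : min z 0 - min w 0 ≤ z - w := by grind
  have h3 := add_one_le_exp (min w 0 - min z 0)
  have h4 : truncExp w = truncExp z * exp (min w 0 - min z 0) := by
    simp only [truncExp, ← exp_add]
    ring_nf
  have h5 : truncExp z ≤ 1 := (le_abs_self _).trans (abs_truncExp_le z)
  have h6 : 0 < truncExp z := exp_pos _
  have h7 : truncExp w ≤ truncExp z := exp_le_exp.2 h1
  rw [abs_of_nonneg (by linarith), abs_of_nonneg (by linarith)]
  rw [h4]
  nlinarith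

section fixedPoint

open BoundedContinuousFunction

variable {A c : ℝ}

lemma existsUnique_eq_neg_mul_expPotential (hA : 0 < A) (hc : 1 ≤ c) :
    ∃! z : ℝ → ℝ, Continuous z ∧ ∀ s, z s = -A * expPotential c (truncExp ∘ z) s := by
  have hc0 : 0 < c := by linarith
  let w : ℝ → ℝ := fun s => exp (A * exp (2 * s))
  have hw : Continuous w := by fun_prop
  have hw0 : ∀ s, 0 < w s := fun s => exp_pos _
  have hcomp : ∀ z : ℝ → ℝ, Continuous z → Continuous (truncExp ∘ z) :=
    fun z hz => continuous_truncExp.comp hz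
  have hbd : ∀ (z : ℝ → ℝ) s, |(truncExp ∘ z) s| ≤ 1 := fun z s => abs_truncExp_le _
  have hcont : ∀ z : ℝ → ℝ, Continuous z → Continuous (expPotential c (truncExp ∘ z)) :=
    fun z hz => continuous_iff_continuousAt.2 fun s =>
      (hasDerivAt_expPotential hc0 (hcomp z hz) (hbd z) s).continuousAt
  have hbound : ∀ (z : ℝ → ℝ) s, ‖-A * expPotential c (truncExp ∘ z) s / w s‖ ≤ 1 := by
    intro z s
    rw [norm_div, norm_mul, norm_neg, norm_of_nonneg hA.le, norm_of_nonneg (hw0 s).le,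
      div_le_one (hw0 s)]
    have h1 := mul_le_mul_of_nonneg_left (abs_expPotential_le hc0 (hbd z) s) hA.le
    have h2 : A * exp (2 * s) ≤ w s := by
      have := add_one_le_exp (A * exp (2 * s))
      simp only [w]
      linarith
    have h3 : 1 / c ≤ 1 := (div_le_one hc0).2 hc
    have h4 : 0 < A * exp (2 * s) := by positivity
    simp only [norm_eq_abs]
    nlinarith
  let Φ : (ℝ →ᵇ ℝ) → (ℝ →ᵇ ℝ) := fun u => ofNormedAddCommGroup
    (fun s => -A * expPotential c (truncExp ∘ fun t => u t * w t) s / w s)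
    ((continuous_const.mul (hcont _ (by fun_prop))).div hw fun s => (hw0 s).ne') 1 (hbound _)
  have hΦ : ContractingWith (1 / 2) Φ := by
    refine ⟨by rw [← NNReal.coe_lt_coe]; norm_num, LipschitzWith.of_dist_le_mul fun u v => ?_⟩
    rw [dist_le (by positivity)]
    intro s
    have key := abs_expPotential_sub_le (D := dist u v) hc0 hA dist_nonneg
      (hcomp (fun t => u t * w t) (by fun_prop)) (hbd _)
      (hcomp (fun t => v t * w t) (by fun_prop)) (hbd _) (fun t => by
        refine (abs_truncExp_sub_le _ _).trans ?_
        rw [← sub_mul, abs_mul, abs_of_pos (hw0 t)]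
        exact mul_le_mul_of_nonneg_right
          (by simpa [Real.dist_eq] using dist_coe_le_dist (f := u) (g := v) t) (hw0 t).le) s
    have heq : dist (Φ u s) (Φ v s) = A * |expPotential c (truncExp ∘ fun t => u t * w t) s
        - expPotential c (truncExp ∘ fun t => v t * w t) s| / w s := by
      simp only [Φ, coe_ofNormedAddCommGroup, Real.dist_eq]
      rw [← sub_div, ← mul_sub, abs_div, abs_mul, abs_neg, abs_of_pos hA, abs_of_pos (hw0 s)]
    rw [heq, div_le_iff₀ (hw0 s)]
    refine (mul_le_mul_of_nonneg_left key hA.le).trans ?_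
    have h1 : A * (dist u v / (2 * A * c) * w s) = (1 / c) * (1 / 2 * dist u v * w s) := by
      field_simp
    have h2 : 1 / c ≤ 1 := (div_le_one hc0).2 hc
    have h3 : 0 ≤ 1 / 2 * dist u v * w s := by have := hw0 s; positivity
    change A * (dist u v / (2 * A * c) * w s) ≤ _
    rw [h1]
    push_cast
    nlinarith
  let u := ContractingWith.fixedPoint Φ hΦ
  have hu : Φ u = u := hΦ.fixedPoint_isFixedPt
  refine ⟨fun s => u s * w s, ⟨by fun_prop, fun s => ?_⟩, ?_⟩
  · have := DFunLike.congr_fun hu s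
    simp only [Φ, coe_ofNormedAddCommGroup] at this
    simp only
    rw [← this, div_mul_cancel₀ _ (hw0 s).ne']
  · rintro z ⟨hz, hfix⟩
    let v : ℝ →ᵇ ℝ := ofNormedAddCommGroup (fun s => z s / w s)
      (hz.div hw fun s => (hw0 s).ne') 1 fun s => by
        rw [hfix s]
        exact hbound z s
    have hvz : (fun s => v s * w s) = z := by
      funext s
      exact div_mul_cancel₀ _ (hw0 s).ne'
    have hv : Φ v = v := by
      ext s
      simp only [Φ, coe_ofNormedAddCommGroup, hvz]
      rw [← hfix s]
      rfl
    have : v = u := hΦ.fixedPoint_unique hv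
    rw [← this, hvz]

variable {m : ℝ} {z : ℝ → ℝ}

/-- Regular solutions of the Emden-Fowler form of the Gelfand equation solve the corresponding
integral equation. -/
lemma eq_neg_mul_expPotential_of_ode (hA : 0 < A) (hm : 0 < m) (hz : Differentiable ℝ z)
    (hz' : Differentiable ℝ (deriv z))
    (hode : ∀ s, deriv (deriv z) s + m * deriv z s + A * exp (2 * s) * exp (z s) = 0)
    (h0 : Tendsto z atBot (nhds 0))
    (h1 : Tendsto (fun s => exp (-s) * deriv z s) atBot (nhds 0)) (s : ℝ) :
    z s = -A * expPotential (m + 2) (truncExp ∘ z) s := by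
  have hflux : ∀ s, HasDerivAt (fun t => exp (m * t) * deriv z t)
      (-A * (exp ((m + 2) * s) * exp (z s))) s := by
    intro s
    convert! (hasDerivAt_exp_mul m s).mul (hz' s).hasDerivAt using 1
    rw [add_mul, exp_add]
    linear_combination (-exp (m * s)) * hode s
  have hflux0 : Tendsto (fun t => exp (m * t) * deriv z t) atBot (nhds 0) := by
    have := (tendsto_exp_mul_atBot (c := m + 1) (by linarith)).mul h1
    rw [mul_zero] at this
    refine this.congr fun t => ?_
    rw [← mul_assoc, ← exp_add]
    ring_nf
  have hnonpos : ∀ s, z s ≤ 0 := by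
    have hanti : Antitone fun t => exp (m * t) * deriv z t :=
      antitone_of_deriv_nonpos (fun s => (hflux s).differentiableAt) fun s => by
        rw [(hflux s).deriv]
        have : 0 < A * (exp ((m + 2) * s) * exp (z s)) := by positivity
        linarith
    have hle : ∀ t, exp (m * t) * deriv z t ≤ 0 := hanti.ge_of_tendsto hflux0
    have : Antitone z := antitone_of_deriv_nonpos hz fun t => by
      nlinarith [hle t, exp_pos (m * t)]
    exact this.ge_of_tendsto h0
  have htr : ∀ s, (truncExp ∘ z) s = exp (z s) := fun s => by
    simp [truncExp, min_eq_left (hnonpos s)]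
  have hb : ∀ s, |(truncExp ∘ z) s| ≤ 1 := fun s => abs_truncExp_le _
  have hh : Continuous (truncExp ∘ z) := continuous_truncExp.comp hz.continuous
  have hc : 0 < m + 2 := by linarith
  have heq : (fun t => exp (m * t) * deriv z t)
      = fun t => -A * expIntegral (m + 2) (truncExp ∘ z) t :=
    eq_of_hasDerivAt_of_tendsto hflux
      (fun s => by
        have := (hasDerivAt_expIntegral hc hh hb s).const_mul (-A)
        rwa [htr] at this) hflux0
      (by simpa using (tendsto_expIntegral hc hb).const_mul (-A))
  have hderiv : ∀ t, deriv z t = -A * (exp (2 * t) * expMean (m + 2) (truncExp ∘ z) t) := by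
    intro t
    have := congr_fun heq t
    simp only [expIntegral_eq_exp_mul_expMean, add_mul, exp_add] at this
    refine mul_left_cancel₀ (exp_pos (m * t)).ne' (this.trans ?_)
    ring
  exact congr_fun (eq_of_hasDerivAt_of_tendsto (g := fun t =>
      -A * expPotential (m + 2) (truncExp ∘ z) t) (fun s => (hz s).hasDerivAt)
    (fun s => by
      rw [hderiv]
      exact (hasDerivAt_expPotential hc hh hb s).const_mul (-A)) h0
    (by simpa using (tendsto_expPotential hc hb).const_mul (-A))) s

/-- Solutions of the integral equation are regular solutions of the Emden-Fowler form of the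
Gelfand equation. -/
lemma ode_of_eq_neg_mul_expPotential (hA : 0 < A) (hm : 0 < m) (hz : Continuous z)
    (hfix : ∀ s, z s = -A * expPotential (m + 2) (truncExp ∘ z) s) :
    ContDiff ℝ 2 z ∧
    (∀ s, deriv (deriv z) s + m * deriv z s + A * exp (2 * s) * exp (z s) = 0) ∧
    Tendsto z atBot (nhds 0) ∧
    Tendsto (fun s => exp (-s) * deriv z s) atBot (nhds 0) := by
  have hb : ∀ s, |(truncExp ∘ z) s| ≤ 1 := fun s => abs_truncExp_le _
  have hh : Continuous (truncExp ∘ z) := continuous_truncExp.comp hz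
  have hc : 0 < m + 2 := by linarith
  have hmean : ∀ s, 0 ≤ expMean (m + 2) (truncExp ∘ z) s := fun s =>
    mul_nonneg (exp_pos _).le (MeasureTheory.integral_nonneg fun t =>
      mul_nonneg (exp_pos _).le (exp_pos _).le)
  have hpot : ∀ s, 0 ≤ expPotential (m + 2) (truncExp ∘ z) s := fun s =>
    MeasureTheory.integral_nonneg fun t => mul_nonneg (exp_pos _).le (hmean t)
  have hnonpos : ∀ s, z s ≤ 0 := fun s => by
    rw [hfix s]
    nlinarith [hpot s]
  have htr : ∀ s, (truncExp ∘ z) s = exp (z s) := fun s => by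
    simp [truncExp, min_eq_left (hnonpos s)]
  have hz1 : ∀ s, HasDerivAt z (-A * (exp (2 * s) * expMean (m + 2) (truncExp ∘ z) s)) s := by
    intro s
    have := (hasDerivAt_expPotential hc hh hb s).const_mul (-A)
    rwa [← funext hfix] at this
  have hd1 : deriv z = fun s => -A * (exp (2 * s) * expMean (m + 2) (truncExp ∘ z) s) :=
    funext fun s => (hz1 s).deriv
  have hz2 : ∀ s, HasDerivAt (deriv z)
      (-m * deriv z s - A * exp (2 * s) * exp (z s)) s := by
    intro s
    have := ((hasDerivAt_exp_mul 2 s).mul (hasDerivAt_expMean hc hh hb s)).const_mul (-A)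
    rw [hd1]
    convert! this using 1
    rw [htr]
    ring
  have hd2 : deriv (deriv z) = fun s => -m * deriv z s - A * exp (2 * s) * exp (z s) :=
    funext fun s => (hz2 s).deriv
  have hzd : Continuous (deriv z) := continuous_iff_continuousAt.2 fun s => (hz2 s).continuousAt
  refine ⟨?_, fun s => ?_, ?_, ?_⟩
  · rw [show (2 : WithTop ℕ∞) = 1 + 1 from (one_add_one_eq_two).symm, contDiff_succ_iff_deriv]
    refine ⟨fun s => (hz1 s).differentiableAt, by simp, contDiff_one_iff_deriv.2
      ⟨fun s => (hz2 s).differentiableAt, ?_⟩⟩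
    rw [hd2]
    fun_prop
  · rw [hd2]
    ring
  · rw [funext hfix]
    simpa using (tendsto_expPotential hc hb).const_mul (-A)
  · refine squeeze_zero_norm (a := fun s => A * (1 / (m + 2)) * exp (1 * s)) (fun s => ?_)
      (by simpa using (tendsto_exp_mul_atBot one_pos).const_mul (A * (1 / (m + 2))))
    have h1 : exp (-s) * deriv z s
        = -(A * expMean (m + 2) (truncExp ∘ z) s * exp (1 * s)) := by
      have : exp (1 * s) = exp (-s) * exp (2 * s) := by
        rw [← exp_add]
        ring_nf
      rw [this, hd1]
      ring
    have h2 := abs_expMean_le hc hb s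
    rw [h1, norm_neg, norm_mul, norm_mul, norm_of_nonneg hA.le, norm_of_nonneg (exp_pos _).le]
    exact mul_le_mul_of_nonneg_right (mul_le_mul_of_nonneg_left h2 hA.le) (exp_pos _).le

end fixedPoint

lemma two_mul_exp_add_eq {m α κ : ℝ} (hm : 0 < m) (hκ : κ = log (2 * m)) (s z : ℝ) :
    2 * m * exp (z + (2 * s - κ + α)) = exp α * exp (2 * s) * exp z := by
  have : 2 * m = exp κ := by rw [hκ, exp_log (by positivity)]
  rw [this, ← exp_add, ← exp_add, ← exp_add]
  ring_nf

lemma hasDerivAt_add_affine {z : ℝ → ℝ} {z' s : ℝ} (hz : HasDerivAt z z' s) (a b : ℝ) :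
    HasDerivAt (fun t => z t + (2 * t - a + b)) (z' + 2) s := by
  have := hz.add ((((hasDerivAt_id s).const_mul 2).sub_const a).add_const b)
  simpa using! this

theorem stmt_5 (N : ℕ) (hN : 4 ≤ N) (α κ : ℝ)
    (hκ : κ = Real.log (2 * ((N : ℝ) - 3))) :
    ∃! x : ℝ → ℝ,
      ContDiff ℝ 2 x ∧
      (∀ s : ℝ, deriv (deriv x) s + ((N : ℝ) - 3) * deriv x s
          + 2 * ((N : ℝ) - 3) * (Real.exp (x s) - 1) = 0) ∧
      Tendsto (fun s => x s - 2 * s + κ - α) atBot (nhds 0) ∧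
      Tendsto (fun s => Real.exp (-s) * (deriv x s - 2)) atBot (nhds 0) := by
  have hm : 0 < (N : ℝ) - 3 := by
    have : (4 : ℝ) ≤ N := by exact_mod_cast hN
    linarith
  generalize (N : ℝ) - 3 = m at hm hκ
  have key : ∀ z : ℝ → ℝ,
      (ContDiff ℝ 2 (fun s => z s + (2 * s - κ + α)) ∧
      (∀ s : ℝ, deriv (deriv fun s => z s + (2 * s - κ + α)) s
          + m * deriv (fun s => z s + (2 * s - κ + α)) s
          + 2 * m * (Real.exp (z s + (2 * s - κ + α)) - 1) = 0) ∧
      Tendsto (fun s => z s + (2 * s - κ + α) - 2 * s + κ - α) atBot (nhds 0) ∧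
      Tendsto (fun s => Real.exp (-s) * (deriv (fun s => z s + (2 * s - κ + α)) s - 2))
        atBot (nhds 0)) ↔
      Continuous z ∧ ∀ s, z s = -exp α * expPotential (m + 2) (truncExp ∘ z) s := by
    intro z
    have hlin : ContDiff ℝ 2 fun s : ℝ => 2 * s - κ + α := by fun_prop
    have hCD : ContDiff ℝ 2 (fun s => z s + (2 * s - κ + α)) ↔ ContDiff ℝ 2 z :=
      ⟨fun h => by simpa using! h.sub hlin, fun h => h.add hlin⟩
    have hlim : (fun s => z s + (2 * s - κ + α) - 2 * s + κ - α) = z := by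
      funext s
      ring
    rw [hCD, hlim]
    have hderiv : ContDiff ℝ 2 z →
        (deriv fun s => z s + (2 * s - κ + α)) = fun s => deriv z s + 2 := fun h =>
      funext fun s => (hasDerivAt_add_affine
        (h.differentiable two_ne_zero s).hasDerivAt κ α).deriv
    constructor
    · rintro ⟨h, hode, h0, h1⟩
      rw [hderiv h] at hode h1
      have h' : ContDiff ℝ (1 + 1) z := by rwa [one_add_one_eq_two]
      refine ⟨h.continuous, eq_neg_mul_expPotential_of_ode (exp_pos α) hm
        (h.differentiable two_ne_zero)
        ((contDiff_succ_iff_deriv.1 h').2.2.differentiable one_ne_zero) (fun s => ?_) h0 ?_⟩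
      · have := hode s
        rw [mul_sub, two_mul_exp_add_eq hm hκ, deriv_add_const] at this
        linear_combination this
      · simpa using h1
    · rintro ⟨hz, hfix⟩
      obtain ⟨h, hode, h0, h1⟩ := ode_of_eq_neg_mul_expPotential (exp_pos α) hm hz hfix
      rw [hderiv h]
      refine ⟨h, fun s => ?_, h0, by simpa using h1⟩
      rw [mul_sub, two_mul_exp_add_eq hm hκ, deriv_add_const]
      linear_combination hode s
  obtain ⟨z, hz, huniq⟩ :=
    existsUnique_eq_neg_mul_expPotential (exp_pos α) (show 1 ≤ m + 2 by linarith)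
  refine ⟨fun s => z s + (2 * s - κ + α), (key z).2 hz, fun x hx => ?_⟩
  have hx' : x = fun s => (fun t => x t - (2 * t - κ + α)) s + (2 * s - κ + α) := by
    funext s
    ring
  rw [hx'] at hx ⊢
  rw [huniq _ ((key _).1 hx)]
end
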